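/- arXiv:1905.05646 — 7 statements merged into one kernel-verified Lean document; each statement's English description precedes it below -/
import Mathlib

section
/- Assume that the number d of distinct letters in the pattern v satisfies d > 1. Then for every integer r ≥ 0 there exist a positive integer M_r and real constants C_r ∈ (0,∞) and K_r ∈ [0,∞) such that lim_{n→∞} g_r^v(k,n)/(n^{M_r}(d−1)^n) = C_r and lim_{n→∞} f_r^v(k,n)/(n^{M_r}(d−1)^n) = K_r. -/
open Filter Topology

/-- The number of occurrences of the pattern `v : Fin ℓ → Fin k` in the word
`w : Fin n → Fin k`: the number of strictly increasing index tuples along which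
`w` is order-isomorphic (including equalities) to `v`. -/
noncomputable def occ (k ℓ n : ℕ) (v : Fin ℓ → Fin k) (w : Fin n → Fin k) : ℕ :=
  Nat.card {j : Fin ℓ → Fin n // StrictMono j ∧
    ∀ p q : Fin ℓ, (w (j p) < w (j q) ↔ v p < v q) ∧ (w (j p) = w (j q) ↔ v p = v q)}

/-- `fword k ℓ v r n` = number of words in `[k]^n` containing `v` exactly `r` times. -/
noncomputable def fword (k ℓ : ℕ) (v : Fin ℓ → Fin k) (r n : ℕ) : ℕ :=
  Nat.card {w : Fin n → Fin k // occ k ℓ n v w = r}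

/-- `gword k ℓ v r n` = number of words in `[k]^n` containing `v` at most `r` times. -/
noncomputable def gword (k ℓ : ℕ) (v : Fin ℓ → Fin k) (r n : ℕ) : ℕ :=
  ∑ j ∈ Finset.range (r + 1), fword k ℓ v j n

/-- The number of distinct letters appearing in the pattern `v`. -/
noncomputable def dLetters (k ℓ : ℕ) (v : Fin ℓ → Fin k) : ℕ :=
  (Finset.univ.image v).card

/-- A real sequence is either summable or asymptotic to `C * n ^ M` for some `C > 0`. -/
def SummableOrPolynomial (a : ℕ → ℝ) : Prop :=
  Summable a ∨ ∃ (M : ℕ) (C : ℝ), 0 < C ∧ Tendsto (fun n : ℕ => a n / (n : ℝ) ^ M) atTop (𝓝 C)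

theorem tendsto_div_pow_zero {a : ℕ → ℝ} {M N : ℕ} {C : ℝ} (hMN : M < N)
    (h : Tendsto (fun n : ℕ => a n / (n : ℝ) ^ M) atTop (𝓝 C)) :
    Tendsto (fun n : ℕ => a n / (n : ℝ) ^ N) atTop (𝓝 0) := by
  have h1 : Tendsto (fun n : ℕ => ((n : ℝ) ^ (N - M))⁻¹) atTop (𝓝 0) :=
    ((tendsto_pow_atTop (by omega)).comp tendsto_natCast_atTop_atTop).inv_tendsto_atTop
  have h2 := h.mul h1
  rw [mul_zero] at h2
  refine h2.congr fun n => ?_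
  rw [div_eq_mul_inv, mul_assoc, ← mul_inv, ← pow_add, Nat.add_sub_cancel' hMN.le, div_eq_mul_inv]

theorem Summable.tendsto_div_pow_zero {a : ℕ → ℝ} (h : Summable a) (N : ℕ) :
    Tendsto (fun n : ℕ => a n / (n : ℝ) ^ N) atTop (𝓝 0) := by
  have h0 : Tendsto (fun n : ℕ => a n / (n : ℝ) ^ 0) atTop (𝓝 0) := by
    simpa using h.tendsto_atTop_zero
  rcases N.eq_zero_or_pos with rfl | hN
  · exact h0
  · exact _root_.tendsto_div_pow_zero hN h0

theorem SummableOrPolynomial.add {a b : ℕ → ℝ} (ha : SummableOrPolynomial a)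
    (hb : SummableOrPolynomial b) : SummableOrPolynomial (fun n => a n + b n) := by
  have key : ∀ {x y : ℕ → ℝ} {M : ℕ} {C D : ℝ}, 0 < C → 0 ≤ D →
      Tendsto (fun n : ℕ => x n / (n : ℝ) ^ M) atTop (𝓝 C) →
      Tendsto (fun n : ℕ => y n / (n : ℝ) ^ M) atTop (𝓝 D) →
      SummableOrPolynomial (fun n => x n + y n) := fun {x y M C D} hC hD hx hy =>
    Or.inr ⟨M, C + D, by positivity, by simpa only [add_div] using hx.add hy⟩
  rcases ha with ha | ⟨M, C, hC, ha⟩ <;> rcases hb with hb | ⟨N, D, hD, hb⟩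
  · exact Or.inl (ha.add hb)
  · simpa only [add_comm] using key hD le_rfl hb (ha.tendsto_div_pow_zero N)
  · exact key hC le_rfl ha (hb.tendsto_div_pow_zero M)
  · rcases lt_trichotomy M N with h | rfl | h
    · simpa only [add_comm] using key hD le_rfl hb (tendsto_div_pow_zero h ha)
    · exact key hC hD.le ha hb
    · exact key hC le_rfl ha (tendsto_div_pow_zero h hb)

theorem SummableOrPolynomial.sum {ι : Type*} (s : Finset ι) {a : ι → ℕ → ℝ}
    (h : ∀ i ∈ s, SummableOrPolynomial (a i)) :
    SummableOrPolynomial (fun n => ∑ i ∈ s, a i n) := by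
  classical
  induction s using Finset.induction_on with
  | empty => exact Or.inl (by simp)
  | insert i s hi ih =>
    simp only [Finset.sum_insert hi]
    exact (h i (by simp)).add (ih fun j hj => h j (by simp [hj]))

theorem SummableOrPolynomial.div_const {a : ℕ → ℝ} (ha : SummableOrPolynomial a) {D : ℝ}
    (hD : 0 < D) : SummableOrPolynomial (fun n => a n / D) := by
  rcases ha with ha | ⟨M, C, hC, ha⟩
  · exact Or.inl (ha.div_const D)
  · refine Or.inr ⟨M, C / D, by positivity, ?_⟩
    simpa only [div_right_comm] using ha.div_const D

theorem sum_range_choose_fixed (n M : ℕ) :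
    ∑ j ∈ Finset.range n, j.choose M = n.choose (M + 1) := by
  induction n with
  | zero => simp
  | succ n ih => rw [Finset.sum_range_succ, ih, Nat.choose_succ_succ, add_comm]

theorem le_choose_succ_add (n M : ℕ) : n ≤ n.choose (M + 1) + M := by
  induction n with
  | zero => simp
  | succ n ih =>
    rcases lt_or_ge n M with h | h
    · omega
    · have := Nat.choose_pos h
      rw [Nat.choose_succ_succ']
      omega

theorem tendsto_choose_div_pow (M : ℕ) :
    Tendsto (fun n : ℕ => (n.choose M : ℝ) / (n : ℝ) ^ M) atTop (𝓝 ((M.factorial : ℝ)⁻¹)) := by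
  have hne : ∀ᶠ n : ℕ in atTop, (n : ℝ) ^ M / (M.factorial : ℝ) ≠ 0 := by
    filter_upwards [eventually_gt_atTop 0] with n hn
    positivity
  have h := ((Asymptotics.isEquivalent_iff_tendsto_one hne).1 (isEquivalent_choose M)).mul_const
    ((M.factorial : ℝ)⁻¹)
  rw [one_mul] at h
  refine h.congr' ?_
  filter_upwards [eventually_gt_atTop 0] with n hn
  have : (M.factorial : ℝ) ≠ 0 := by positivity
  have : (n : ℝ) ^ M ≠ 0 := by positivity
  simp only [Pi.div_apply]
  field_simp

theorem tendsto_sum_range_div_pow {h : ℕ → ℝ} {M : ℕ} {C : ℝ}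
    (hh : Tendsto (fun n : ℕ => h n / (n : ℝ) ^ M) atTop (𝓝 C)) :
    Tendsto (fun n : ℕ => (∑ j ∈ Finset.range n, h j) / (n : ℝ) ^ (M + 1)) atTop
      (𝓝 (C / (M + 1))) := by
  have hM : (M.factorial : ℝ) ≠ 0 := by positivity
  have h1 : Tendsto (fun n : ℕ => h n / (n.choose M : ℝ)) atTop (𝓝 (C * M.factorial)) := by
    have := hh.div (tendsto_choose_div_pow M) (by positivity)
    rw [div_inv_eq_mul] at this
    refine this.congr' ?_
    filter_upwards [eventually_gt_atTop 0] with n hn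
    have : (n : ℝ) ^ M ≠ 0 := by positivity
    simp only [Pi.div_apply]
    field_simp
  have h2 : (fun n : ℕ => h n - C * M.factorial * (n.choose M : ℝ)) =o[atTop]
      (fun n : ℕ => (n.choose M : ℝ)) := by
    rw [Asymptotics.isLittleO_iff_tendsto']
    · have := h1.sub_const (C * M.factorial)
      rw [sub_self] at this
      refine this.congr' ?_
      filter_upwards [eventually_ge_atTop M] with n hn
      have : (n.choose M : ℝ) ≠ 0 := by exact_mod_cast (Nat.choose_pos hn).ne'
      field_simp
    · filter_upwards [eventually_ge_atTop M] with n hn h0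
      exact absurd h0 (by exact_mod_cast (Nat.choose_pos hn).ne')
  have hsum : ∀ n : ℕ, ∑ j ∈ Finset.range n, (j.choose M : ℝ) = (n.choose (M + 1) : ℝ) :=
    fun n => by exact_mod_cast sum_range_choose_fixed n M
  have h3 := h2.sum_range (fun n => by positivity) (by
    simp only [hsum]
    refine tendsto_atTop_mono' _ ?_ (tendsto_atTop_add_const_right atTop (-(M : ℝ))
      tendsto_natCast_atTop_atTop)
    filter_upwards with n
    have : (n : ℝ) ≤ n.choose (M + 1) + M := by exact_mod_cast le_choose_succ_add n M
    linarith)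
  simp only [hsum, Finset.sum_sub_distrib, ← Finset.mul_sum] at h3
  have h4 := h3.tendsto_div_nhds_zero
  have h5 := (h4.add_const (C * M.factorial)).mul (tendsto_choose_div_pow (M + 1))
  have e : (0 + C * M.factorial) * ((M + 1).factorial : ℝ)⁻¹ = C / (M + 1) := by
    rw [Nat.factorial_succ]; push_cast; field_simp; ring
  rw [e] at h5
  refine h5.congr' ?_
  filter_upwards [eventually_ge_atTop (M + 1)] with n hn
  have : (n.choose (M + 1) : ℝ) ≠ 0 := by exact_mod_cast (Nat.choose_pos hn).ne'
  have : (n : ℝ) ≠ 0 := by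
    have : n ≠ 0 := by omega
    exact_mod_cast this
  field_simp
  ring

theorem tendsto_zero_of_contracting {x δ : ℕ → ℝ} {ρ : ℝ} (hρ0 : 0 ≤ ρ) (hρ : ρ < 1)
    (hδ : Tendsto δ atTop (𝓝 0)) (hx : ∀ᶠ n in atTop, |x (n + 1)| ≤ ρ * |x n| + δ n) :
    Tendsto x atTop (𝓝 0) := by
  rw [Metric.tendsto_atTop]
  intro ε hε
  have h1 : ∀ᶠ n in atTop, δ n < (1 - ρ) * (ε / 2) :=
    hδ.eventually_lt_const (by have := sub_pos.2 hρ; positivity)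
  obtain ⟨N, hN⟩ := eventually_atTop.1 (hx.and h1)
  have h2 : ∀ m, |x (N + m)| ≤ ρ ^ m * |x N| + ε / 2 := by
    intro m
    induction m with
    | zero => simp; positivity
    | succ m ih =>
      obtain ⟨ha, hb⟩ := hN (N + m) (by omega)
      have := mul_le_mul_of_nonneg_left ih hρ0
      rw [← add_assoc, pow_succ]
      nlinarith
  have h3 : Tendsto (fun m : ℕ => ρ ^ m * |x N|) atTop (𝓝 0) := by
    simpa using (tendsto_pow_atTop_nhds_zero_of_lt_one hρ0 hρ).mul_const (|x N|)
  obtain ⟨m₀, hm⟩ := eventually_atTop.1 (h3.eventually_lt_const (half_pos hε))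
  refine ⟨N + m₀, fun n hn => ?_⟩
  have := h2 (n - N)
  have h4 := hm (n - N) (by omega)
  rw [Nat.add_sub_cancel' (by omega)] at this
  rw [Real.dist_eq, sub_zero]
  linarith

theorem tendsto_div_pow_of_recurrence {a h : ℕ → ℝ} {θ C : ℝ} {M : ℕ} (hθ0 : 0 ≤ θ) (hθ : θ < 1)
    (ha : ∀ n, a (n + 1) = θ * a n + h n)
    (hh : Tendsto (fun n : ℕ => h n / (n : ℝ) ^ M) atTop (𝓝 C)) :
    Tendsto (fun n : ℕ => a n / (n : ℝ) ^ M) atTop (𝓝 (C / (1 - θ))) := by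
  have hθ' : 1 - θ ≠ 0 := (sub_pos.2 hθ).ne'
  set A := C / (1 - θ) with hA
  have hr : Tendsto (fun n : ℕ => ((n : ℝ) / (n + 1)) ^ M) atTop (𝓝 1) := by
    simpa using (tendsto_natCast_div_add_atTop (1 : ℝ)).pow M
  have hδ : Tendsto (fun n : ℕ => |((n : ℝ) / (n + 1)) ^ M * (θ * A + h n / (n : ℝ) ^ M) - A|)
      atTop (𝓝 0) := by
    have := ((hr.mul (hh.const_add (θ * A))).sub_const A).abs
    have e : |1 * (θ * A + C) - A| = 0 := by
      rw [hA, abs_eq_zero]; field_simp; ring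
    rwa [e] at this
  have hx : Tendsto (fun n : ℕ => a n / (n : ℝ) ^ M - A) atTop (𝓝 0) := by
    refine tendsto_zero_of_contracting hθ0 hθ hδ ?_
    filter_upwards [eventually_gt_atTop 0] with n hn
    have hn' : (0 : ℝ) < n := by exact_mod_cast hn
    have e : a (n + 1) / ((n + 1 : ℕ) : ℝ) ^ M - A =
        ((n : ℝ) / (n + 1)) ^ M * θ * (a n / (n : ℝ) ^ M - A) +
          (((n : ℝ) / (n + 1)) ^ M * (θ * A + h n / (n : ℝ) ^ M) - A) := by
      rw [ha]; push_cast; rw [div_pow]; field_simp; ring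
    rw [e]
    refine (abs_add_le _ _).trans (add_le_add_left ?_ _)
    rw [abs_mul]
    refine mul_le_mul_of_nonneg_right ?_ (abs_nonneg _)
    rw [abs_of_nonneg (by positivity)]
    refine mul_le_of_le_one_left hθ0 (pow_le_one₀ (by positivity) ?_)
    rw [div_le_one (by positivity)]
    linarith
  simpa using hx.add_const A

theorem SummableOrPolynomial.of_recurrence {a h : ℕ → ℝ} {θ : ℝ} (hθ0 : 0 ≤ θ) (hθ : θ ≤ 1)
    (ha0 : 0 < a 0) (ha : ∀ n, 0 ≤ a n) (hh0 : ∀ n, 0 ≤ h n)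
    (hrec : ∀ n, a (n + 1) = θ * a n + h n) (hh : SummableOrPolynomial h) :
    SummableOrPolynomial a := by
  rcases hθ.lt_or_eq with hθ | rfl
  · have hθ' := sub_pos.2 hθ
    rcases hh with hh | ⟨M, C, hC, hh⟩
    · refine Or.inl (summable_of_sum_range_le (c := (a 0 + ∑' n, h n) / (1 - θ)) ha fun n => ?_)
      rw [le_div_iff₀ hθ']
      have h1 : ∑ i ∈ Finset.range (n + 1), a i =
          θ * ∑ i ∈ Finset.range n, a i + ∑ i ∈ Finset.range n, h i + a 0 := by
        rw [Finset.sum_range_succ', Finset.mul_sum, ← Finset.sum_add_distrib]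
        simp only [hrec]
      have h2 := hh.sum_le_tsum (Finset.range n) fun i _ => hh0 i
      rw [Finset.sum_range_succ] at h1
      linarith [ha n]
    · exact Or.inr ⟨M, C / (1 - θ), by positivity, tendsto_div_pow_of_recurrence hθ0 hθ hrec hh⟩
  · have hsum : ∀ n, a n = a 0 + ∑ j ∈ Finset.range n, h j := by
      intro n
      induction n with
      | zero => simp
      | succ n ih => rw [Finset.sum_range_succ, hrec, ih]; ring
    rcases hh with hh | ⟨M, C, hC, hh⟩
    · refine Or.inr ⟨0, a 0 + ∑' n, h n, add_pos_of_pos_of_nonneg ha0 (tsum_nonneg hh0), ?_⟩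
      simpa [← hsum] using hh.hasSum.tendsto_sum_nat.const_add (a 0)
    · refine Or.inr ⟨M + 1, C / (M + 1), by positivity, ?_⟩
      have h1 : Tendsto (fun n : ℕ => a 0 / (n : ℝ) ^ 0) atTop (𝓝 (a 0)) := by simp
      have h2 := (tendsto_div_pow_zero (Nat.succ_pos M) h1).add (tendsto_sum_range_div_pow hh)
      rw [zero_add] at h2
      simpa only [← add_div, ← hsum] using h2

/-- The number of words of length `n` in a language `L`. -/
noncomputable def langCount {α : Type*} (L : Set (List α)) (n : ℕ) : ℕ :=
  Nat.card {w : Fin n → α // List.ofFn w ∈ L}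

/-- The left quotient of the language `L` by the letter `x`. -/
def leftQuotient {α : Type*} (L : Set (List α)) (x : α) : Set (List α) := {l | x :: l ∈ L}

/-- A language that contains all the (scattered) subwords of its words. -/
def SubwordClosed {α : Type*} (L : Set (List α)) : Prop :=
  ∀ ⦃l⦄, l ∈ L → ∀ ⦃l'⦄, l'.Sublist l → l' ∈ L

section Languages

variable {α : Type*}

theorem langCount_mono [Finite α] {L L' : Set (List α)} (h : L ⊆ L') (n : ℕ) :
    langCount L n ≤ langCount L' n :=
  Nat.card_le_card_of_injective (Subtype.map id fun _ hw => h hw)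
    (Subtype.map_injective _ Function.injective_id)

theorem langCount_zero_pos {L : Set (List α)} (h : [] ∈ L) : 0 < langCount L 0 := by
  have : Nonempty {w : Fin 0 → α // List.ofFn w ∈ L} := ⟨⟨Fin.elim0, by simpa using h⟩⟩
  exact Nat.card_pos

theorem langCount_succ [Fintype α] (L : Set (List α)) (n : ℕ) :
    langCount L (n + 1) = ∑ x, langCount (leftQuotient L x) n := by
  let e : {w : Fin (n + 1) → α // List.ofFn w ∈ L} ≃
      Σ x, {w : Fin n → α // List.ofFn w ∈ leftQuotient L x} :=
    { toFun := fun w => ⟨w.1 0, fun i => w.1 i.succ, by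
        have := w.2; rwa [List.ofFn_succ] at this⟩
      invFun := fun p => ⟨Fin.cons p.1 p.2.1, by
        rw [List.ofFn_succ]; exact p.2.2⟩
      left_inv := fun w => Subtype.ext (Fin.cons_self_tail w.1)
      right_inv := fun _ => rfl }
  rw [langCount, Nat.card_congr e, Nat.card_sigma]
  rfl

theorem subwordClosed_leftQuotient {L : Set (List α)} (hL : SubwordClosed L) (x : α) :
    SubwordClosed (leftQuotient L x) :=
  fun _ hl _ h => hL hl (h.cons_cons x)

theorem SubwordClosed.leftQuotient_subset {L : Set (List α)} (hL : SubwordClosed L) (x : α) :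
    leftQuotient L x ⊆ L :=
  fun l hl => hL hl (List.sublist_cons_self x l)

theorem wellQuasiOrdered_sublist [Finite α] : WellQuasiOrdered (List.Sublist (α := α)) := by
  have h := (Set.PartiallyWellOrderedOn.partiallyWellOrderedOn_sublistForall₂ (α := α) (· = ·)
    (s := Set.univ)
    (Set.partiallyWellOrderedOn_univ_iff.2 (Finite.wellQuasiOrdered _)))
  simp only [Set.mem_univ, implies_true, Set.ofPred_true, Set.partiallyWellOrderedOn_univ_iff] at h
  intro f
  obtain ⟨m, n, hmn, hs⟩ := h f
  obtain ⟨l, hl, hs⟩ := List.sublistForall₂_iff.1 hs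
  rw [List.forall₂_eq_eq_eq] at hl
  exact ⟨m, n, hmn, hl ▸ hs⟩

theorem wellFounded_subwordClosed [Finite α] :
    WellFounded fun L L' : {L : Set (List α) // SubwordClosed L} => L.1 ⊂ L'.1 := by
  rw [wellFounded_iff_isEmpty_descending_chain]
  refine ⟨fun ⟨f, hf⟩ => ?_⟩
  have hanti : Antitone fun n => (f n).1 := antitone_nat_of_succ_le fun n => (hf n).subset
  choose w hw hw' using fun n => Set.exists_of_ssubset (hf n)
  obtain ⟨m, n, hmn, hs⟩ := wellQuasiOrdered_sublist w
  exact hw' m ((f (m + 1)).2 (hanti hmn (hw n)) hs)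

theorem mem_of_forall_leftQuotient_eq {L : Set (List α)} (h0 : [] ∈ L) {T : Finset α}
    (hT : ∀ x ∈ T, leftQuotient L x = L) {l : List α} (hl : ∀ x ∈ l, x ∈ T) : l ∈ L := by
  induction l with
  | nil => exact h0
  | cons x l ih =>
    have h1 : l ∈ L := ih fun y hy => hl y (List.mem_cons_of_mem x hy)
    rw [← hT x (hl x List.mem_cons_self)] at h1
    exact h1

/-- Growth of a subword-closed language containing no full language over `D + 1` letters. -/
theorem SubwordClosed.summableOrPolynomial [Fintype α] {D : ℕ} (hD : 0 < D) {L : Set (List α)}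
    (hL : SubwordClosed L)
    (hT : ∀ T : Finset α, D < T.card → ∃ l : List α, (∀ x ∈ l, x ∈ T) ∧ l ∉ L) :
    SummableOrPolynomial fun n => (langCount L n : ℝ) / (D : ℝ) ^ n := by
  classical
  have hD' : (0 : ℝ) < D := by exact_mod_cast hD
  suffices H : ∀ K : {L : Set (List α) // SubwordClosed L},
      (∀ T : Finset α, D < T.card → ∃ l : List α, (∀ x ∈ l, x ∈ T) ∧ l ∉ K.1) →
      SummableOrPolynomial fun n => (langCount K.1 n : ℝ) / (D : ℝ) ^ n from H ⟨L, hL⟩ hT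
  intro K
  refine wellFounded_subwordClosed.induction (C := fun K =>
    (∀ T : Finset α, D < T.card → ∃ l : List α, (∀ x ∈ l, x ∈ T) ∧ l ∉ K.1) →
      SummableOrPolynomial fun n => (langCount K.1 n : ℝ) / (D : ℝ) ^ n) K fun K ih => ?_
  obtain ⟨L, hL⟩ := K
  intro hT
  by_cases h0 : [] ∈ L
  · let S : Finset α := {x | leftQuotient L x = L}
    have hSL : ∀ x ∈ S, leftQuotient L x = L := fun x hx => by simpa [S] using hx
    have hS : S.card ≤ D := by
      by_contra! h
      obtain ⟨l, hl, hl'⟩ := hT S h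
      exact hl' (mem_of_forall_leftQuotient_eq h0 hSL hl)
    refine SummableOrPolynomial.of_recurrence (θ := S.card / D)
      (h := fun n => ∑ x ∈ Sᶜ, (langCount (leftQuotient L x) n : ℝ) / (D : ℝ) ^ n / D)
      (by positivity) ?_ ?_ (fun n => by positivity)
      (fun n => Finset.sum_nonneg fun x _ => by positivity) ?_ ?_
    · rw [div_le_one hD']
      exact_mod_cast hS
    · have := langCount_zero_pos h0
      simpa using this
    · intro n
      have hs : ∑ x ∈ S, (langCount (leftQuotient L x) n : ℝ) = S.card * langCount L n := by
        rw [Finset.sum_congr rfl fun x hx => by rw [hSL x hx], Finset.sum_const,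
          nsmul_eq_mul]
      simp only [langCount_succ, Nat.cast_sum, ← Finset.sum_div]
      rw [← Finset.sum_add_sum_compl S, hs, pow_succ]
      field_simp
    · refine SummableOrPolynomial.sum _ fun x hx => SummableOrPolynomial.div_const ?_ hD'
      have hne : leftQuotient L x ≠ L := by simpa [S] using hx
      refine ih ⟨_, subwordClosed_leftQuotient hL x⟩ ((hL.leftQuotient_subset x).ssubset_of_ne hne) fun T h => ?_
      obtain ⟨l, hl, hl'⟩ := hT T h
      exact ⟨l, hl, fun hc => hl' (hL.leftQuotient_subset x hc)⟩
  · have hempty : L = ∅ := Set.eq_empty_of_forall_notMem fun l hl => h0 (hL hl (List.nil_sublist l))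
    refine Or.inl ?_
    have : ∀ n, langCount L n = 0 := fun n => by simp [langCount, hempty]
    simp [this]

/-- Words over `D` in which no `a` precedes a `b`. -/
def wordsWithout (D : Finset α) (a b : α) : Set (List α) :=
  {l | (∀ x ∈ l, x ∈ D) ∧ l.Pairwise fun x y => ¬ (x = a ∧ y = b)}

theorem pow_le_langCount [Fintype α] (D : Finset α) (n : ℕ) :
    D.card ^ n ≤ langCount {l : List α | ∀ x ∈ l, x ∈ D} n := by
  induction n with
  | zero => exact langCount_zero_pos (by simp)
  | succ n ih =>
    rw [langCount_succ]
    calc D.card ^ (n + 1) ≤ ∑ x ∈ D, langCount {l : List α | ∀ x ∈ l, x ∈ D} n := by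
          rw [Finset.sum_const, smul_eq_mul, pow_succ']
          gcongr
      _ ≤ ∑ x ∈ D, langCount (leftQuotient {l : List α | ∀ x ∈ l, x ∈ D} x) n :=
          Finset.sum_le_sum fun x hx => langCount_mono (fun l hl => by
            simpa [leftQuotient, hx] using hl) n
      _ ≤ _ := Finset.sum_le_univ_sum_of_nonneg fun _ => Nat.zero_le _

theorem mul_pow_le_langCount_wordsWithout [Fintype α] [DecidableEq α] {D : Finset α} {a b : α}
    (ha : a ∈ D) (hb : b ∈ D) (n : ℕ) :
    n * (D.card - 1) ^ n ≤ (D.card - 1) * langCount (wordsWithout D a b) n := by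
  induction n with
  | zero => simp
  | succ n ih =>
    have h1 : (D.card - 1) * langCount (wordsWithout D a b) n ≤
        ∑ x ∈ D.erase a, langCount (leftQuotient (wordsWithout D a b) x) n := by
      rw [← Finset.card_erase_of_mem ha, ← smul_eq_mul, ← Finset.sum_const]
      refine Finset.sum_le_sum fun x hx => langCount_mono (fun l hl => ?_) n
      obtain ⟨hxa, hxD⟩ := Finset.mem_erase.1 hx
      refine ⟨by simpa [hxD] using hl.1, List.pairwise_cons.2 ⟨fun y _ h => hxa h.1, hl.2⟩⟩
    have h2 : (D.card - 1) ^ n ≤ langCount (leftQuotient (wordsWithout D a b) a) n := by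
      rw [← Finset.card_erase_of_mem hb]
      refine (pow_le_langCount _ n).trans (langCount_mono (fun l hl => ?_) n)
      have hl' : ∀ x ∈ l, x ≠ b ∧ x ∈ D := fun x hx => Finset.mem_erase.1 (hl x hx)
      refine ⟨?_, List.pairwise_cons.2 ⟨fun y hy h => (hl' y hy).1 h.2, ?_⟩⟩
      · simpa [ha] using fun x hx => (hl' x hx).2
      · exact List.pairwise_of_forall_mem_list fun x _ y hy h => (hl' y hy).1 h.2
    have h3 : (D.card - 1) * langCount (wordsWithout D a b) n + (D.card - 1) ^ n ≤
        langCount (wordsWithout D a b) (n + 1) := by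
      rw [langCount_succ]
      refine le_trans ?_ (Finset.sum_le_univ_sum_of_nonneg (s := D) fun _ => Nat.zero_le _)
      rw [← Finset.sum_erase_add _ _ ha]
      exact add_le_add h1 h2
    calc (n + 1) * (D.card - 1) ^ (n + 1)
        = (D.card - 1) * (n * (D.card - 1) ^ n + (D.card - 1) ^ n) := by ring
      _ ≤ _ := Nat.mul_le_mul_left _ ((add_le_add_left ih _).trans h3)

end Languages

section Patterns

variable {k ℓ : ℕ} {v : Fin ℓ → Fin k}

theorem occ_le_of_strictMono {m n : ℕ} {w : Fin m → Fin k} {w' : Fin n → Fin k}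
    {f : Fin m → Fin n} (hf : StrictMono f) (h : ∀ i, w' (f i) = w i) :
    occ k ℓ m v w ≤ occ k ℓ n v w' :=
  Nat.card_le_card_of_injective
    (Subtype.map (fun j => f ∘ j) fun j hj => ⟨hf.comp hj.1, by simpa [h] using hj.2⟩)
    (Subtype.map_injective _ hf.injective.comp_left)

theorem occ_get_ofFn {n : ℕ} (w : Fin n → Fin k) :
    occ k ℓ (List.ofFn w).length v (List.ofFn w).get = occ k ℓ n v w :=
  le_antisymm
    (occ_le_of_strictMono (f := Fin.cast List.length_ofFn) (fun _ _ h => h) fun i => by simp; rfl)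
    (occ_le_of_strictMono (f := Fin.cast List.length_ofFn.symm) (fun _ _ h => h) fun i => by simp)

/-- The language of words with at most `r` occurrences of `v`. -/
def patternLang (k ℓ : ℕ) (v : Fin ℓ → Fin k) (r : ℕ) : Set (List (Fin k)) :=
  {l | occ k ℓ l.length v l.get ≤ r}

theorem ofFn_mem_patternLang {r n : ℕ} {w : Fin n → Fin k} :
    List.ofFn w ∈ patternLang k ℓ v r ↔ occ k ℓ n v w ≤ r := by
  rw [patternLang, Set.mem_ofPred_eq, occ_get_ofFn]

theorem subwordClosed_patternLang (r : ℕ) : SubwordClosed (patternLang k ℓ v r) := by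
  intro l hl l' h
  obtain ⟨f, hf⟩ := List.sublist_iff_exists_fin_orderEmbedding_get_eq.1 h
  exact (occ_le_of_strictMono f.strictMono fun i => (hf i).symm).trans hl

theorem gword_eq_langCount (r n : ℕ) : gword k ℓ v r n = langCount (patternLang k ℓ v r) n := by
  classical
  simp only [gword, fword, langCount, ofFn_mem_patternLang, Nat.card_eq_fintype_card,
    Fintype.card_subtype]
  rw [Finset.card_eq_sum_card_fiberwise (f := occ k ℓ n v) (t := Finset.range (r + 1))
    fun w hw => by simpa [Nat.lt_succ_iff] using hw]
  refine Finset.sum_congr rfl fun j hj => congrArg Finset.card ?_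
  ext w
  have := Finset.mem_range.1 hj
  simp only [Finset.mem_filter, Finset.mem_univ, true_and]
  omega

theorem exists_notMem_patternLang (hl : 0 < ℓ) (r : ℕ) {T : Finset (Fin k)}
    (hT : dLetters k ℓ v ≤ T.card) :
    ∃ l : List (Fin k), (∀ x ∈ l, x ∈ T) ∧ l ∉ patternLang k ℓ v r := by
  obtain ⟨T', hT', hcard⟩ := Finset.exists_subset_card_eq hT
  let φ : Finset.univ.image v ≃o T' :=
    ((Finset.univ.image v).orderIsoOfFin rfl).symm.trans (T'.orderIsoOfFin hcard)
  let u : Fin ℓ → Fin k := fun p => φ ⟨v p, Finset.mem_image_of_mem v (Finset.mem_univ p)⟩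
  have hult : ∀ p q, u p < u q ↔ v p < v q := fun p q => by
    simp only [u, Subtype.coe_lt_coe, OrderIso.lt_iff_lt, Subtype.mk_lt_mk]
  have hueq : ∀ p q, u p = u q ↔ v p = v q := fun p q => by
    simp only [u, Subtype.coe_inj, EmbeddingLike.apply_eq_iff_eq, Subtype.mk.injEq]
  let w : Fin ((r + 1) * ℓ) → Fin k := fun i => u (finProdFinEquiv.symm i).2
  refine ⟨List.ofFn w, ?_, ?_⟩
  · intro x hx
    obtain ⟨i, rfl⟩ := List.mem_ofFn.1 hx
    exact hT' (Subtype.prop _)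
  · rw [ofFn_mem_patternLang, not_le]
    let g : Fin (r + 1) → {j : Fin ℓ → Fin ((r + 1) * ℓ) // StrictMono j ∧
        ∀ p q : Fin ℓ, (w (j p) < w (j q) ↔ v p < v q) ∧ (w (j p) = w (j q) ↔ v p = v q)} :=
      fun t => ⟨fun p => finProdFinEquiv (t, p), fun p q hpq => by
        rw [Fin.lt_def] at hpq ⊢
        simpa using hpq, fun p q => by
          simp only [w, Equiv.symm_apply_apply, hult, hueq, and_self]⟩
    have hg : Function.Injective g := fun s t hst => by
      have := congrFun (congrArg Subtype.val hst) ⟨0, hl⟩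
      exact congrArg Prod.fst (finProdFinEquiv.injective this)
    have := Nat.card_le_card_of_injective g hg
    rw [Nat.card_eq_fintype_card, Fintype.card_fin] at this
    exact this

theorem eq_of_orderIsomorphic {u : Fin ℓ → Fin k} (hu : ∀ p, u p ∈ Finset.univ.image v)
    (h : ∀ p q, (u p < u q ↔ v p < v q) ∧ (u p = u q ↔ v p = v q)) : u = v := by
  have hs : ∀ x : Finset.univ.image v, ∃ p, v p = x := fun x => by
    obtain ⟨p, -, hp⟩ := Finset.mem_image.1 x.2
    exact ⟨p, hp⟩
  choose s hs using hs
  let φ : Finset.univ.image v → Finset.univ.image v := fun x => ⟨u (s x), hu _⟩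
  have hφ : StrictMono φ := fun x y hxy => by
    change u (s x) < u (s y)
    rwa [(h _ _).1, hs, hs]
  funext p
  let x : Finset.univ.image v := ⟨v p, Finset.mem_image_of_mem v (Finset.mem_univ p)⟩
  have h1 : φ x = x := le_antisymm hφ.apply_le hφ.le_apply
  rw [(h p (s x)).2.2 (hs x).symm]
  exact congrArg Subtype.val h1

theorem wordsWithout_subset_patternLang (r : ℕ) {p q : Fin ℓ} (hpq : p < q) :
    wordsWithout (Finset.univ.image v) (v p) (v q) ⊆ patternLang k ℓ v r := by
  intro l hl
  have : IsEmpty {j : Fin ℓ → Fin l.length // StrictMono j ∧ ∀ p q : Fin ℓ,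
      (l.get (j p) < l.get (j q) ↔ v p < v q) ∧ (l.get (j p) = l.get (j q) ↔ v p = v q)} := by
    refine ⟨fun ⟨j, hj, h⟩ => ?_⟩
    have e := congrFun (eq_of_orderIsomorphic (u := fun p => l.get (j p))
      (fun p => hl.1 _ (List.get_mem _ _)) h)
    exact List.pairwise_iff_get.1 hl.2 (j p) (j q) (hj hpq) ⟨e p, e q⟩
  rw [patternLang, Set.mem_ofPred_eq, occ, Nat.card_of_isEmpty]
  exact Nat.zero_le r

theorem mul_pow_le_gword (hl : 1 < ℓ) (r n : ℕ) :
    n * (dLetters k ℓ v - 1) ^ n ≤ (dLetters k ℓ v - 1) * gword k ℓ v r n := by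
  let p : Fin ℓ := ⟨0, by omega⟩
  let q : Fin ℓ := ⟨1, hl⟩
  have hpq : p < q := Fin.mk_lt_mk.2 one_pos
  rw [gword_eq_langCount]
  exact (mul_pow_le_langCount_wordsWithout (Finset.mem_image_of_mem v (Finset.mem_univ p))
    (Finset.mem_image_of_mem v (Finset.mem_univ q)) n).trans
    (Nat.mul_le_mul_left _ (langCount_mono (wordsWithout_subset_patternLang r hpq) n))

theorem exists_tendsto_gword (hl : 1 < ℓ) (hd : 1 < dLetters k ℓ v) (r : ℕ) :
    ∃ (M : ℕ) (C : ℝ), 0 < M ∧ 0 < C ∧ Tendsto (fun n : ℕ =>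
      (gword k ℓ v r n : ℝ) / ((n : ℝ) ^ M * ((dLetters k ℓ v : ℝ) - 1) ^ n)) atTop (𝓝 C) := by
  have hD : (((dLetters k ℓ v - 1 : ℕ) : ℝ)) = (dLetters k ℓ v : ℝ) - 1 := by
    rw [Nat.cast_sub hd.le, Nat.cast_one]
  have hD0 : (0 : ℝ) < (dLetters k ℓ v : ℝ) - 1 := by
    rw [sub_pos]; exact_mod_cast hd
  set D : ℝ := (dLetters k ℓ v : ℝ) - 1
  have hlow : ∀ n : ℕ, (n : ℝ) / D ≤ (gword k ℓ v r n : ℝ) / D ^ n := fun n => by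
    have : (n : ℝ) * D ^ n ≤ D * gword k ℓ v r n := by
      rw [← hD]; exact_mod_cast mul_pow_le_gword hl r n
    rw [div_le_div_iff₀ hD0 (by positivity)]
    linarith
  have hinf : Tendsto (fun n : ℕ => (gword k ℓ v r n : ℝ) / D ^ n) atTop atTop :=
    tendsto_atTop_mono hlow (tendsto_natCast_atTop_atTop.atTop_div_const hD0)
  have hgood := (subwordClosed_patternLang (v := v) r).summableOrPolynomial
    (D := dLetters k ℓ v - 1) (by omega)
    fun T hT => exists_notMem_patternLang (by omega) r (by omega)
  simp only [← gword_eq_langCount, hD] at hgood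
  rcases hgood with h | ⟨M, C, hC, h⟩
  · exact absurd h.tendsto_atTop_zero (not_tendsto_nhds_of_tendsto_atTop hinf 0)
  · refine ⟨M, C, Nat.pos_of_ne_zero ?_, hC, ?_⟩
    · rintro rfl
      simp only [pow_zero, div_one] at h
      exact not_tendsto_nhds_of_tendsto_atTop hinf C h
    · simpa only [div_div, mul_comm] using h

end Patterns

/-- Theorem A(b): if `d > 1`, then for every `r ≥ 0` there exist a positive integer `M_r`
and constants `C_r ∈ (0,∞)`, `K_r ∈ [0,∞)` such that
`g_r^v(k,n)/(n^{M_r}(d-1)^n) → C_r` and `f_r^v(k,n)/(n^{M_r}(d-1)^n) → K_r`. -/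
theorem polynomial_refinement_words (k ℓ : ℕ) (hk : 1 ≤ k) (hl : 2 ≤ ℓ)
    (v : Fin ℓ → Fin k) (hd : 1 < dLetters k ℓ v) (r : ℕ) :
    ∃ (M : ℕ) (C K : ℝ), 0 < M ∧ 0 < C ∧ 0 ≤ K ∧
      Tendsto (fun n : ℕ =>
          (gword k ℓ v r n : ℝ) / ((n : ℝ) ^ M * ((dLetters k ℓ v : ℝ) - 1) ^ n))
        atTop (𝓝 C) ∧
      Tendsto (fun n : ℕ =>
          (fword k ℓ v r n : ℝ) / ((n : ℝ) ^ M * ((dLetters k ℓ v : ℝ) - 1) ^ n))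
        atTop (𝓝 K) := by
  have hD0 : (0 : ℝ) < (dLetters k ℓ v : ℝ) - 1 := by
    rw [sub_pos]; exact_mod_cast hd
  obtain ⟨M, C, hM, hC, hg⟩ := exists_tendsto_gword hl hd r
  suffices H : ∃ K, Tendsto (fun n : ℕ =>
      (fword k ℓ v r n : ℝ) / ((n : ℝ) ^ M * ((dLetters k ℓ v : ℝ) - 1) ^ n)) atTop (𝓝 K) by
    obtain ⟨K, hK⟩ := H
    exact ⟨M, C, K, hM, hC, ge_of_tendsto' hK fun n => by positivity, hg, hK⟩
  cases r with
  | zero => exact ⟨C, by simpa [gword] using hg⟩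
  | succ r =>
    obtain ⟨N, B, hN, hB, hg'⟩ := exists_tendsto_gword hl hd r
    have hsucc : ∀ n, gword k ℓ v (r + 1) n = gword k ℓ v r n + fword k ℓ v (r + 1) n :=
      fun n => Finset.sum_range_succ _ _
    simp only [div_mul_eq_div_div_swap] at hg hg' ⊢
    have hNM : N ≤ M := by
      by_contra! h
      refine hB.not_ge (le_of_tendsto_of_tendsto' hg' (tendsto_div_pow_zero h hg) fun n => ?_)
      rw [hsucc, Nat.cast_add]
      gcongr
      exact le_add_of_nonneg_right (Nat.cast_nonneg _)
    obtain ⟨B', hB'⟩ : ∃ B', Tendsto (fun n : ℕ => (gword k ℓ v r n : ℝ) /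
        ((dLetters k ℓ v : ℝ) - 1) ^ n / (n : ℝ) ^ M) atTop (𝓝 B') := by
      rcases hNM.lt_or_eq with h | rfl
      · exact ⟨0, tendsto_div_pow_zero h hg'⟩
      · exact ⟨B, hg'⟩
    refine ⟨C - B', (hg.sub hB').congr fun n => ?_⟩
    rw [hsucc, Nat.cast_add]
    ring
end

section
/- Let r ≥ 0 be an integer and let d be the number of distinct letters in the pattern v. (i) For every word u ∈ [k]^* with occ_v(u) ≤ r, the number of letters a ∈ [k] such that ua ∼_{v;r} u is at most d − 1. (ii) The number of letters a ∈ [k] such that the one-letter word a satisfies a ∼_{v;r} ε (where ε is the empty word) is exactly d − 1. -/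
open Filter Topology

/-- Number of occurrences of the pattern `v` in a word given as a list of letters. -/
noncomputable def occL (k ℓ : ℕ) (v : Fin ℓ → Fin k) (w : List (Fin k)) : ℕ :=
  occ k ℓ w.length v w.get

/-- The equivalence relation `∼_{v;r}` on `[k]^*`. -/
def wequiv (k ℓ : ℕ) (v : Fin ℓ → Fin k) (r : ℕ) (w w' : List (Fin k)) : Prop :=
  ∀ u : List (Fin k), ∀ m : ℕ, m ≤ r →
    (occL k ℓ v (w ++ u) = m ↔ occL k ℓ v (w' ++ u) = m)

/-- A strictly increasing map of positions preserving letters transports occurrences. -/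
def occMap {k ℓ m n : ℕ} {v : Fin ℓ → Fin k} {w : Fin m → Fin k} {w' : Fin n → Fin k}
    (f : Fin m → Fin n) (hf : StrictMono f) (hw : ∀ i, w' (f i) = w i)
    (j : {j : Fin ℓ → Fin m // StrictMono j ∧
      ∀ p q : Fin ℓ, (w (j p) < w (j q) ↔ v p < v q) ∧ (w (j p) = w (j q) ↔ v p = v q)}) :
    {j : Fin ℓ → Fin n // StrictMono j ∧
      ∀ p q : Fin ℓ, (w' (j p) < w' (j q) ↔ v p < v q) ∧ (w' (j p) = w' (j q) ↔ v p = v q)} :=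
  ⟨f ∘ j.1, hf.comp j.2.1, fun p q => by simpa only [Function.comp, hw] using j.2.2 p q⟩

theorem occL_add_le_append {k ℓ : ℕ} (hl : 0 < ℓ) (v : Fin ℓ → Fin k) (u w : List (Fin k)) :
    occL k ℓ v u + occL k ℓ v w ≤ occL k ℓ v (u ++ w) := by
  have hlen : (u ++ w).length = u.length + w.length := List.length_append
  let f : Fin u.length → Fin (u ++ w).length := fun i => ⟨i, by omega⟩
  let g : Fin w.length → Fin (u ++ w).length := fun i => ⟨u.length + i, by omega⟩
  have hf : StrictMono f := fun a b h => h
  have hg : StrictMono g := fun a b h => Nat.add_lt_add_left h u.length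
  have hfw : ∀ i, (u ++ w).get (f i) = u.get i := fun i => by simp [f]
  have hgw : ∀ i, (u ++ w).get (g i) = w.get i := fun i => by simp [g]
  rw [occL, occL, occL, occ, occ, occ, ← Nat.card_sum]
  refine Nat.card_le_card_of_injective
    (Sum.elim (occMap f hf hfw) (occMap g hg hgw)) (Function.Injective.sumElim ?_ ?_ ?_)
  · intro a b h
    exact Subtype.ext (hf.injective.comp_left (congrArg Subtype.val h))
  · intro a b h
    exact Subtype.ext (hg.injective.comp_left (congrArg Subtype.val h))
  · intro a b h
    have h0 := congrArg Fin.val (congrFun (congrArg Subtype.val h) ⟨0, hl⟩)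
    simp only [occMap, Function.comp, f, g] at h0
    omega

theorem occL_cons_le {k ℓ : ℕ} (hl : 0 < ℓ) (v : Fin ℓ → Fin k) (a : Fin k) (u : List (Fin k))
    (h : ∀ j : Fin ℓ → Fin (a :: u).length, StrictMono j →
      (∀ p q : Fin ℓ, ((a :: u).get (j p) < (a :: u).get (j q) ↔ v p < v q) ∧
        ((a :: u).get (j p) = (a :: u).get (j q) ↔ v p = v q)) → (j ⟨0, hl⟩).val ≠ 0) :
    occL k ℓ v (a :: u) ≤ occL k ℓ v u := by
  have key : ∀ j : {j : Fin ℓ → Fin (a :: u).length // StrictMono j ∧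
      ∀ p q : Fin ℓ, ((a :: u).get (j p) < (a :: u).get (j q) ↔ v p < v q) ∧
        ((a :: u).get (j p) = (a :: u).get (j q) ↔ v p = v q)}, ∃ i : Fin ℓ → Fin u.length,
          ∀ p, j.1 p = (i p).succ := by
    intro j
    have h0 : ∀ p, j.1 p ≠ 0 := fun p hp => by
      have h1 : (j.1 ⟨0, hl⟩).val ≤ (j.1 p).val := j.2.1.monotone (Nat.zero_le p.val)
      rw [hp] at h1
      exact h _ j.2.1 j.2.2 (Nat.le_zero.mp h1)
    exact ⟨fun p => (j.1 p).pred (h0 p), fun p => (Fin.succ_pred _ _).symm⟩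
  choose i hi using key
  refine Nat.card_le_card_of_injective (fun j => ⟨i j, ?_, ?_⟩) ?_
  · intro p q hpq
    have h1 := j.2.1 hpq
    rw [hi, hi] at h1
    exact Fin.succ_lt_succ_iff.mp h1
  · intro p q
    have h1 := j.2.2 p q
    rw [hi, hi] at h1
    exact h1
  · intro j j' hjj
    have h1 : i j = i j' := congrArg Subtype.val hjj
    exact Subtype.ext (funext fun p => by rw [hi, hi, h1])

theorem occL_eq_zero_of_length_lt {k ℓ : ℕ} (v : Fin ℓ → Fin k) (u : List (Fin k))
    (h : u.length < ℓ) : occL k ℓ v u = 0 := by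
  rw [occL, occ, Nat.card_eq_zero]
  refine Or.inl ⟨fun j => ?_⟩
  have := Fintype.card_le_of_injective j.1 j.2.1.injective
  simp only [Fintype.card_fin] at this
  omega

theorem occL_ofFn_pos {k ℓ : ℕ} (v f : Fin ℓ → Fin k)
    (hf : ∀ p q, v p < v q → f p < f q) (hf' : ∀ p q, v p = v q → f p = f q) :
    0 < occL k ℓ v (List.ofFn f) := by
  rw [occL, occ, Nat.card_pos_iff]
  refine ⟨⟨Fin.cast List.length_ofFn.symm, fun a b h => h, fun p q => ?_⟩, inferInstance⟩
  simp only [List.get_ofFn, Fin.cast_cast, Fin.cast_eq_self]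
  have h1 := hf p q
  have h2 := hf q p
  have h3 := hf' p q
  grind

theorem wequiv.append {k ℓ : ℕ} {v : Fin ℓ → Fin k} {r : ℕ} {w w' : List (Fin k)}
    (h : wequiv k ℓ v r w w') (x : List (Fin k)) : wequiv k ℓ v r (w ++ x) (w' ++ x) := by
  intro u m hm
  simpa only [List.append_assoc] using h (x ++ u) m hm

/-- Words all of whose letters are loops at `u` can be absorbed by `u`. -/
theorem wequiv_append_of_forall_loop {k ℓ : ℕ} {v : Fin ℓ → Fin k} {r : ℕ} {u : List (Fin k)}
    (w : List (Fin k)) (h : ∀ a ∈ w, wequiv k ℓ v r (u ++ [a]) u) :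
    wequiv k ℓ v r (u ++ w) u := by
  induction w with
  | nil => simp [wequiv]
  | cons a w ih =>
    intro x m hm
    have h1 := (h a List.mem_cons_self).append w x m hm
    have h2 := ih (fun b hb => h b (List.mem_cons_of_mem a hb)) x m hm
    rw [← h2, ← h1, List.append_assoc u [a] w, List.singleton_append]

/-- The number of distinct letters of `v` smaller than `x`. -/
def letterRank {k ℓ : ℕ} (v : Fin ℓ → Fin k) (x : Fin k) : ℕ :=
  ((Finset.univ.image v).filter (· < x)).card

theorem letterRank_lt_letterRank {k ℓ : ℕ} (v : Fin ℓ → Fin k) {p q : Fin ℓ} (h : v p < v q) :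
    letterRank v (v p) < letterRank v (v q) := by
  refine Finset.card_lt_card (Finset.ssubset_iff_of_subset ?_ |>.mpr ⟨v p, ?_, ?_⟩)
  · intro x hx
    rw [Finset.mem_filter] at hx ⊢
    exact ⟨hx.1, hx.2.trans h⟩
  · simp [h]
  · simp

theorem letterRank_add_card_gt {k ℓ : ℕ} (v : Fin ℓ → Fin k) (p : Fin ℓ) :
    letterRank v (v p) + ((Finset.univ.image v).filter (v p < ·)).card + 1 = dLetters k ℓ v := by
  have h1 := Finset.card_filter_add_card_filter_not (s := Finset.univ.image v) (· < v p)
  have h2 : (Finset.univ.image v).filter (fun x => ¬ x < v p) =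
      insert (v p) ((Finset.univ.image v).filter (v p < ·)) := by
    ext x
    simp only [Finset.mem_filter, Finset.mem_insert, Finset.mem_image, Finset.mem_univ, true_and,
      not_lt, le_iff_eq_or_lt, eq_comm (a := v p)]
    constructor
    · rintro ⟨hx, h | h⟩ <;> simp_all
    · rintro (h | h)
      · exact ⟨⟨p, h.symm⟩, Or.inl h⟩
      · exact ⟨h.1, Or.inr h.2⟩
  rw [h2, Finset.card_insert_of_notMem (by simp)] at h1
  rw [letterRank, dLetters]
  omega

theorem letterRank_lt_dLetters {k ℓ : ℕ} (v : Fin ℓ → Fin k) (p : Fin ℓ) :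
    letterRank v (v p) < dLetters k ℓ v := by
  have := letterRank_add_card_gt v p
  omega

theorem card_loops_lt_dLetters {k ℓ : ℕ} (hl : 0 < ℓ) (v : Fin ℓ → Fin k) (r : ℕ)
    (u : List (Fin k)) (hu : occL k ℓ v u ≤ r) :
    Nat.card {a : Fin k // wequiv k ℓ v r (u ++ [a]) u} < dLetters k ℓ v := by
  classical
  by_contra! hd
  rw [Nat.card_eq_fintype_card, Fintype.card_subtype] at hd
  set L := Finset.univ.filter fun a : Fin k => wequiv k ℓ v r (u ++ [a]) u
  let f : Fin ℓ → Fin k := fun p =>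
    L.orderEmbOfFin rfl ⟨letterRank v (v p), (letterRank_lt_dLetters v p).trans_le hd⟩
  have hpos := occL_ofFn_pos v f
    (fun p q h => (L.orderEmbOfFin rfl).strictMono (letterRank_lt_letterRank v h))
    (fun p q h => by simp only [f, h])
  have hw : wequiv k ℓ v r (u ++ List.ofFn f) u := by
    refine wequiv_append_of_forall_loop _ fun a ha => ?_
    obtain ⟨p, rfl⟩ := (List.mem_ofFn' f a).mp ha
    exact (Finset.mem_filter.mp (Finset.orderEmbOfFin_mem L rfl _)).2
  have h1 := (hw [] _ hu).mpr (by rw [List.append_nil])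
  rw [List.append_nil] at h1
  have h2 := occL_add_le_append hl v u (List.ofFn f)
  omega

/-- If `f` is order-isomorphic to `v`, then `f p` has at least as many letters of the alphabet on
either side as `v p` has letters of `v`. -/
theorem letterRank_le_and_add_card_gt_lt {k ℓ : ℕ} (v f : Fin ℓ → Fin k)
    (h : ∀ p q : Fin ℓ, (f p < f q ↔ v p < v q) ∧ (f p = f q ↔ v p = v q)) (p : Fin ℓ) :
    letterRank v (v p) ≤ (f p).val ∧
      (f p).val + ((Finset.univ.image v).filter (v p < ·)).card < k := by
  have : Nonempty (Fin ℓ) := ⟨p⟩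
  have hinv : ∀ x ∈ Finset.univ.image v, v (Function.invFun v x) = x := fun x hx =>
    Function.invFun_eq (by simpa using hx)
  have hinj : Set.InjOn (fun x => f (Function.invFun v x)) (Finset.univ.image v) := by
    intro x hx y hy hxy
    rw [← hinv x hx, ← hinv y hy]
    exact ((h _ _).2).mp hxy
  constructor
  · rw [letterRank, ← Fin.card_Iio (f p)]
    refine Finset.card_le_card_of_injOn (fun x => f (Function.invFun v x)) (fun x hx => ?_)
      (hinj.mono (Finset.coe_subset.mpr (Finset.filter_subset _ _)))
    obtain ⟨hx, hlt⟩ := Finset.mem_filter.mp hx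
    simp only [Finset.coe_Iio, Set.mem_Iio]
    rwa [(h _ _).1, hinv x hx]
  · have h1 : ((Finset.univ.image v).filter (v p < ·)).card ≤ (Finset.Ioi (f p)).card := by
      refine Finset.card_le_card_of_injOn (fun x => f (Function.invFun v x)) (fun x hx => ?_)
        (hinj.mono (Finset.coe_subset.mpr (Finset.filter_subset _ _)))
      obtain ⟨hx, hlt⟩ := Finset.mem_filter.mp hx
      simp only [Finset.coe_Ioi, Set.mem_Ioi]
      rwa [(h _ _).1, hinv x hx]
    rw [Fin.card_Ioi] at h1
    omega

/-- The letter `a` is not a loop at the empty word iff it can start an occurrence of `v`. -/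
theorem not_wequiv_singleton_nil_iff {k ℓ : ℕ} (hl : 0 < ℓ) (v : Fin ℓ → Fin k) (r : ℕ)
    (a : Fin k) :
    ¬ wequiv k ℓ v r [a] [] ↔ letterRank v (v ⟨0, hl⟩) ≤ a.val ∧
      a.val + ((Finset.univ.image v).filter (v ⟨0, hl⟩ < ·)).card < k := by
  constructor
  · contrapose!
    intro ha u m _
    suffices occL k ℓ v ([a] ++ u) = occL k ℓ v ([] ++ u) by rw [this]
    refine le_antisymm (occL_cons_le hl v a u fun j _ hj h0 => ?_)
      ((Nat.le_add_left _ _).trans (occL_add_le_append hl v [a] u))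
    have h1 := letterRank_le_and_add_card_gt_lt v (fun p => (a :: u).get (j p)) hj ⟨0, hl⟩
    have h2 : (a :: u).get (j ⟨0, hl⟩) = a := by
      rw [show j ⟨0, hl⟩ = ⟨0, Nat.succ_pos _⟩ from Fin.ext h0]
      rfl
    simp only [h2] at h1
    exact absurd (ha h1.1) (not_le.mpr h1.2)
  · rintro ⟨h1, h2⟩ hw
    obtain ⟨n, rfl⟩ : ∃ n, ℓ = n + 1 := ⟨ℓ - 1, by omega⟩
    let f : Fin (n + 1) → Fin k := fun p =>
      ⟨a.val - letterRank v (v ⟨0, hl⟩) + letterRank v (v p), by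
        have h3 := letterRank_add_card_gt v ⟨0, hl⟩
        have h4 := letterRank_lt_dLetters v p
        omega⟩
    have hpos := occL_ofFn_pos v f
      (fun p q h => Nat.add_lt_add_left (letterRank_lt_letterRank v h) _)
      (fun p q h => by simp only [f, h])
    have hf : f 0 = a := Fin.ext (Nat.sub_add_cancel h1)
    rw [List.ofFn_succ, hf] at hpos
    have h3 := (hw (List.ofFn fun i : Fin n => f i.succ) 0 (Nat.zero_le r)).mpr
      (occL_eq_zero_of_length_lt v _ (by simp))
    rw [List.singleton_append] at h3
    omega

theorem card_loops_nil {k ℓ : ℕ} (hl : 0 < ℓ) (v : Fin ℓ → Fin k) (r : ℕ) :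
    Nat.card {a : Fin k // wequiv k ℓ v r [a] []} = dLetters k ℓ v - 1 := by
  classical
  have hd := letterRank_add_card_gt v ⟨0, hl⟩
  have hdk : dLetters k ℓ v ≤ k := (Finset.card_le_univ _).trans_eq (Fintype.card_fin k)
  have hiff := not_wequiv_singleton_nil_iff hl v r
  set s := letterRank v (v ⟨0, hl⟩)
  set t := ((Finset.univ.image v).filter (v ⟨0, hl⟩ < ·)).card
  have h1 := Finset.card_filter_add_card_filter_not (s := (Finset.univ : Finset (Fin k)))
    (fun a => wequiv k ℓ v r [a] [])
  have h2 : (Finset.univ.filter fun a : Fin k => ¬ wequiv k ℓ v r [a] []).card = k - t - s := by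
    rw [← Nat.card_Ico, ← Finset.card_map Fin.valEmbedding]
    congr 1
    ext x
    simp only [Finset.mem_map, Finset.mem_filter, Finset.mem_univ, true_and, hiff,
      Fin.valEmbedding_apply, Finset.mem_Ico]
    constructor
    · rintro ⟨a, ha, rfl⟩
      omega
    · intro hx
      exact ⟨⟨x, by omega⟩, ⟨hx.1, by simp only; omega⟩, rfl⟩
  rw [Finset.card_univ, Fintype.card_fin] at h1
  rw [Nat.card_eq_fintype_card, Fintype.card_subtype]
  omega

/-- Lemma on loops: (i) for every word `u` with `occ_v(u) ≤ r`, the number of letters `a`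
with `ua ∼_{v;r} u` is at most `d - 1`; (ii) the number of letters `a` with
`a ∼_{v;r} ε` is exactly `d - 1`. -/
theorem loops_bound (k ℓ : ℕ) (hk : 1 ≤ k) (hl : 2 ≤ ℓ)
    (v : Fin ℓ → Fin k) (r : ℕ) :
    (∀ u : List (Fin k), occL k ℓ v u ≤ r →
      Nat.card {a : Fin k // wequiv k ℓ v r (u ++ [a]) u} ≤ dLetters k ℓ v - 1) ∧
    Nat.card {a : Fin k // wequiv k ℓ v r [a] []} = dLetters k ℓ v - 1 := by
  exact ⟨fun u hu => Nat.le_sub_one_of_lt (card_loops_lt_dLetters (by omega) v r u hu),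
    card_loops_nil (by omega) v r⟩
end

section
/- For every n ≥ 0, Σ_{w ∈ [k]^n} occ_v(w) = C(n,ℓ)·C(k,d)·k^{n−ℓ}; equivalently, E(X_n) = C(n,ℓ)·C(k,d)/k^ℓ, where C(a,b) denotes the binomial coefficient. -/
open Filter Topology

/-- Two words are order-isomorphic if their letters compare in the same way, equalities included. -/
def OrderIsomorphic {k m ℓ : ℕ} (u : Fin ℓ → Fin m) (v : Fin ℓ → Fin k) : Prop :=
  ∀ p q : Fin ℓ, (u p < u q ↔ v p < v q) ∧ (u p = u q ↔ v p = v q)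

theorem Nat.card_fin_orderEmbedding (d m : ℕ) : Nat.card (Fin d ↪o Fin m) = m.choose d := by
  rw [Nat.card_congr Set.powersetCard.ofFinEmbEquiv, Set.powersetCard.card, Nat.card_fin]

/-- Words order-isomorphic to `v` correspond to order embeddings of the letters of `v`. -/
noncomputable def orderIsomorphicEquiv {k m ℓ : ℕ} (v : Fin ℓ → Fin k) :
    {u : Fin ℓ → Fin m // OrderIsomorphic u v} ≃ ((Finset.univ.image v) ↪o Fin m) where
  toFun u :=
    have h (x : Finset.univ.image v) : ∃ p, v p = x := by
      simpa only [Finset.mem_image, Finset.mem_univ, true_and] using x.2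
    OrderEmbedding.ofStrictMono (fun x => u.1 (h x).choose) fun x y hxy => by
      refine (u.2 _ _).1.2 ?_
      rw [(h x).choose_spec, (h y).choose_spec]
      exact hxy
  invFun f := ⟨fun p => f ⟨v p, by simp⟩, fun p q => by simp⟩
  left_inv u := by
    ext p : 2
    have h : ∃ q, v q = v p := ⟨p, rfl⟩
    exact (u.2 _ _).2.2 h.choose_spec
  right_inv f := by
    ext x : 1
    have h : ∃ p, v p = x := by
      simpa only [Finset.mem_image, Finset.mem_univ, true_and] using x.2
    exact congrArg f (Subtype.ext h.choose_spec)

theorem card_orderIsomorphic {k ℓ : ℕ} (m : ℕ) (v : Fin ℓ → Fin k) :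
    Nat.card {u : Fin ℓ → Fin m // OrderIsomorphic u v} = m.choose (dLetters k ℓ v) := by
  rw [Nat.card_congr (orderIsomorphicEquiv v),
    Nat.card_congr (RelIso.relEmbeddingCongr
      ((Finset.univ.image v).orderIsoOfFin rfl).symm (RelIso.refl _)),
    Nat.card_fin_orderEmbedding, dLetters]

/-- A function whose composite with an injection `j` satisfies `P` consists of that composite and
the values outside the range of `j`. -/
noncomputable def subtypeCompEquiv {α β γ : Type*} {j : α → β} (hj : j.Injective)
    (P : (α → γ) → Prop) :
    {w : β → γ // P (w ∘ j)} ≃ {u : α → γ // P u} × ({b // b ∉ Set.range j} → γ) := by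
  classical
  exact (Equiv.subtypeEquiv
    ((Equiv.piEquivPiSubtypeProd (· ∈ Set.range j) fun _ => γ).trans
      (((Equiv.ofInjective j hj).symm.arrowCongr (Equiv.refl γ)).prodCongr (Equiv.refl _)))
    (q := fun x => P x.1) fun w => Iff.rfl).trans
      Equiv.prodSubtypeFstEquivSubtypeProd

theorem card_subtype_comp {k ℓ n : ℕ} {j : Fin ℓ → Fin n} (hj : j.Injective)
    (P : (Fin ℓ → Fin k) → Prop) :
    Nat.card {w : Fin n → Fin k // P (w ∘ j)} = Nat.card {u // P u} * k ^ (n - ℓ) := by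
  classical
  rw [Nat.card_congr (subtypeCompEquiv hj P), Nat.card_prod, Nat.card_fun, Nat.card_fin]
  congr 2
  rw [Nat.card_eq_fintype_card, Fintype.card_subtype_compl, Fintype.card_fin,
    ← Fintype.card_congr (Equiv.ofInjective j hj), Fintype.card_fin]

theorem card_strictMono (ℓ n : ℕ) :
    Nat.card {j : Fin ℓ → Fin n // StrictMono j} = n.choose ℓ := by
  rw [← Nat.card_fin_orderEmbedding]
  exact Nat.card_congr
    { toFun := fun j => OrderEmbedding.ofStrictMono j.1 j.2
      invFun := fun f => ⟨f, f.strictMono⟩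
      left_inv := fun _ => rfl
      right_inv := fun _ => rfl }

theorem sum_occ {k ℓ : ℕ} (v : Fin ℓ → Fin k) (n : ℕ) :
    ∑ w : Fin n → Fin k, occ k ℓ n v w
      = n.choose ℓ * k.choose (dLetters k ℓ v) * k ^ (n - ℓ) := by
  classical
  let e : (Σ w : Fin n → Fin k, {j : Fin ℓ → Fin n // StrictMono j ∧ OrderIsomorphic (w ∘ j) v}) ≃
      Σ j : {j : Fin ℓ → Fin n // StrictMono j},
        {w : Fin n → Fin k // OrderIsomorphic (w ∘ j.1) v} :=
    { toFun := fun x => ⟨⟨x.2.1, x.2.2.1⟩, ⟨x.1, x.2.2.2⟩⟩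
      invFun := fun x => ⟨x.2.1, ⟨x.1.1, x.1.2, x.2.2⟩⟩
      left_inv := fun _ => rfl
      right_inv := fun _ => rfl }
  calc ∑ w : Fin n → Fin k, occ k ℓ n v w
      = ∑ j : {j : Fin ℓ → Fin n // StrictMono j},
          Nat.card {w : Fin n → Fin k // OrderIsomorphic (w ∘ j.1) v} := by
        rw [← Nat.card_sigma, ← Nat.card_congr e, Nat.card_sigma]
        rfl
    _ = ∑ _j : {j : Fin ℓ → Fin n // StrictMono j},
          k.choose (dLetters k ℓ v) * k ^ (n - ℓ) :=
        Finset.sum_congr rfl fun j _ => by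
          rw [card_subtype_comp j.2.injective (OrderIsomorphic · v), card_orderIsomorphic]
    _ = n.choose ℓ * k.choose (dLetters k ℓ v) * k ^ (n - ℓ) := by
        rw [Finset.sum_const, Finset.card_univ, ← Nat.card_eq_fintype_card, card_strictMono,
          smul_eq_mul, mul_assoc]

/-- The expected number of pattern occurrences:
`Σ_{w ∈ [k]^n} occ_v(w) = C(n,ℓ)·C(k,d)·k^{n-ℓ}`, equivalently
`E(X_n) = C(n,ℓ)·C(k,d)/k^ℓ` for a uniformly random word `W_n ∈ [k]^n`. -/
theorem expected_occurrences (k ℓ : ℕ) (hk : 1 ≤ k) (hl : 2 ≤ ℓ)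
    (v : Fin ℓ → Fin k) (n : ℕ) :
    (∑ w : Fin n → Fin k, occ k ℓ n v w)
        = n.choose ℓ * k.choose (dLetters k ℓ v) * k ^ (n - ℓ) ∧
    (∑ w : Fin n → Fin k, (occ k ℓ n v w : ℝ)) / (k : ℝ) ^ n
        = (n.choose ℓ : ℝ) * (k.choose (dLetters k ℓ v) : ℝ) / (k : ℝ) ^ ℓ := by
  refine ⟨sum_occ v n, ?_⟩
  rw [← Nat.cast_sum, sum_occ]
  rcases lt_or_ge n ℓ with h | h
  · simp [Nat.choose_eq_zero_of_lt h]
  · have hk0 : (k : ℝ) ≠ 0 := by positivity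
    push_cast
    rw [div_eq_div_iff (pow_ne_zero _ hk0) (pow_ne_zero _ hk0), mul_assoc _ ((k : ℝ) ^ (n - ℓ)),
      pow_sub_mul_pow _ h]
end

section
/- Let μ_n = E(X_n), K_n = C(n,ℓ), and Δ_n = C(n,ℓ) − C(n−ℓ,ℓ) − 1, where C(a,b) is the binomial coefficient. Assume k ≥ 2 and n > ℓ. Then for every t ≥ 0: P(X_n ≥ μ_n + t) ≤ exp{ −t²·(1 − Δ_n/(4K_n)) / (2Δ_n·(μ_n + t/3)·(1 − μ_n/K_n)) } and P(X_n ≤ μ_n − t) ≤ exp{ −t²·(1 − Δ_n/(4K_n)) / (2Δ_n·μ_n) }. -/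
open Filter Topology

/-- `μ_n = E(X_n)`, the mean number of occurrences of `v` in a uniformly random word
`W_n ∈ [k]^n`. -/
noncomputable def muX (k ℓ : ℕ) (v : Fin ℓ → Fin k) (n : ℕ) : ℝ :=
  (∑ w : Fin n → Fin k, (occ k ℓ n v w : ℝ)) / (k : ℝ) ^ n

/-- `Var(X_n)`, the variance of the number of occurrences of `v` in a uniformly random
word `W_n ∈ [k]^n`. -/
noncomputable def varX (k ℓ : ℕ) (v : Fin ℓ → Fin k) (n : ℕ) : ℝ :=
  (∑ w : Fin n → Fin k, ((occ k ℓ n v w : ℝ) - muX k ℓ v n) ^ 2) / (k : ℝ) ^ n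

open scoped BigOperators

theorem exp_neg_le_quadratic {x : ℝ} (hx : 0 ≤ x) : Real.exp (-x) ≤ 1 - x + x ^ 2 / 2 := by
  rw [Real.exp_neg, inv_le_iff_one_le_mul₀ (Real.exp_pos x)]
  have h := Real.quadratic_le_exp_of_nonneg hx
  have h' : 0 < 1 - x + x ^ 2 / 2 := by nlinarith [sq_nonneg (x - 1)]
  calc (1 : ℝ) ≤ (1 - x + x ^ 2 / 2) * (1 + x + x ^ 2 / 2) := by nlinarith [sq_nonneg (x ^ 2)]
    _ ≤ _ := by gcongr

theorem two_mul_three_pow_le_factorial (j : ℕ) : 2 * 3 ^ j ≤ (j + 2).factorial := by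
  induction j with
  | zero => simp
  | succ j ih =>
    rw [show j + 1 + 2 = (j + 2) + 1 from rfl, Nat.factorial_succ, pow_succ]
    nlinarith [Nat.zero_le j]

theorem exp_le_bernstein {x : ℝ} (hx : 0 ≤ x) (hx3 : x < 3) :
    Real.exp x ≤ 1 + x + x ^ 2 / (2 * (1 - x / 3)) := by
  have h1 : HasSum (fun n : ℕ => x ^ n / (n.factorial : ℝ)) (Real.exp x) := by
    rw [Real.exp_eq_exp_ℝ]
    exact NormedSpace.expSeries_div_hasSum_exp x
  have h2 := (hasSum_nat_add_iff' 2).2 h1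
  have h3 := (hasSum_geometric_of_lt_one (r := x / 3) (by positivity) (by linarith)).mul_left
    (x ^ 2 / 2)
  have h4 := hasSum_le (fun j => ?_) h2 h3
  · have h5 : x ^ 2 / (2 * (1 - x / 3)) = x ^ 2 / 2 * (1 - x / 3)⁻¹ := by
      rw [div_mul_eq_div_div, div_eq_mul_inv (x ^ 2 / 2)]
    rw [h5]
    simp [Finset.sum_range_succ] at h4
    linarith
  · have h6 : (2 * 3 ^ j : ℝ) ≤ ((j + 2).factorial : ℝ) := by
      exact_mod_cast two_mul_three_pow_le_factorial j
    calc x ^ (j + 2) / ((j + 2).factorial : ℝ) ≤ x ^ (j + 2) / (2 * 3 ^ j) := by gcongr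
      _ = x ^ 2 / 2 * (x / 3) ^ j := by rw [div_pow, pow_add]; field_simp

theorem exp_expect_le {ι : Type*} [Fintype ι] [Nonempty ι] (f : ι → ℝ) :
    Real.exp (𝔼 i, f i) ≤ 𝔼 i, Real.exp (f i) := by
  have h : (0 : ℝ) < Fintype.card ι := by exact_mod_cast Fintype.card_pos
  have := convexOn_exp.map_sum_le (t := (Finset.univ : Finset ι))
    (w := fun _ => (Fintype.card ι : ℝ)⁻¹) (p := f) (fun _ _ => by positivity)
    (by simp [h.ne']) (fun _ _ => Set.mem_univ _)
  simpa [Fintype.expect_eq_sum_div_card, ← Finset.mul_sum, div_eq_inv_mul] using this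

/-- Averaging over the orbit of a transitive action is the same as averaging over the space. -/
theorem expect_smul_eq_expect {G β : Type*} [Group G] [Fintype G] [Fintype β] [MulAction G β]
    [MulAction.IsPretransitive G β] (f : β → ℝ) (b : β) :
    𝔼 g : G, f (g • b) = 𝔼 b' : β, f b' := by
  have : Nonempty β := ⟨b⟩
  have h1 : ∀ b', 𝔼 g : G, f (g • b') = 𝔼 g : G, f (g • b) := by
    intro b'
    obtain ⟨τ, rfl⟩ := MulAction.exists_smul_eq G b b'
    exact Fintype.expect_equiv (Equiv.mulRight τ) _ _ fun g => by simp [mul_smul]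
  calc 𝔼 g : G, f (g • b) = 𝔼 b' : β, 𝔼 g : G, f (g • b') := by simp [h1]
    _ = 𝔼 g : G, 𝔼 b' : β, f (g • b') := Finset.expect_comm _ _ _
    _ = 𝔼 g : G, 𝔼 b' : β, f b' := by
        refine Finset.expect_congr rfl fun g _ => ?_
        exact Fintype.expect_equiv (MulAction.toPerm g) _ _ fun _ => rfl
    _ = _ := by simp

section Independence
variable {ι α : Type*} [Fintype ι] [DecidableEq ι] [Fintype α] [Nonempty α]

theorem expect_mul_of_dependsOn {f g : (ι → α) → ℝ} {s t : Finset ι} (hst : Disjoint s t)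
    (hf : DependsOn f s) (hg : DependsOn g t) :
    𝔼 w, f w * g w = (𝔼 w, f w) * 𝔼 w, g w := by
  let e : ((ι → α) × (ι → α)) ≃ ((ι → α) × (ι → α)) :=
    Function.Involutive.toPerm (fun x => (s.piecewise x.1 x.2, s.piecewise x.2 x.1)) (by
      rintro ⟨x, y⟩
      ext i <;> by_cases hi : i ∈ s <;> simp [hi])
  rw [Fintype.expect_mul_expect]
  calc 𝔼 w, f w * g w = 𝔼 w : ι → α, 𝔼 _w' : ι → α, f w * g w := by simp
    _ = 𝔼 x : (ι → α) × (ι → α), f x.1 * g x.1 := by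
        rw [← Finset.univ_product_univ, Finset.expect_product]
    _ = 𝔼 x : (ι → α) × (ι → α), f x.1 * g x.2 := by
        refine Fintype.expect_equiv e _ _ fun x => ?_
        congr 1
        · exact hf fun i hi => by simp at hi; simp [e, Function.Involutive.toPerm, hi]
        · refine hg fun i hi => ?_
          have : i ∉ s := Finset.disjoint_right.1 hst hi
          simp [e, Function.Involutive.toPerm, this]
    _ = _ := by rw [← Finset.univ_product_univ, Finset.expect_product]

theorem expect_prod_of_dependsOn {κ : Type*} [DecidableEq κ] (I : Finset κ)
    {f : κ → (ι → α) → ℝ} {s : κ → Finset ι} (hs : Pairwise (Function.onFun Disjoint s))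
    (hf : ∀ i, DependsOn (f i) (s i)) :
    𝔼 w, ∏ i ∈ I, f i w = ∏ i ∈ I, 𝔼 w, f i w := by
  induction I using Finset.induction_on with
  | empty => simp
  | insert a I ha ih =>
    simp_rw [Finset.prod_insert ha]
    rw [← ih]
    refine expect_mul_of_dependsOn (s := s a) (t := I.biUnion s) ?_ (hf a) ?_
    · rw [Finset.disjoint_biUnion_right]
      exact fun i hi => hs (by rintro rfl; exact ha hi)
    · intro x y hxy
      refine Finset.prod_congr rfl fun i hi => hf i fun j hj => hxy j ?_
      simp only [Finset.coe_biUnion, Set.mem_iUnion]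
      exact ⟨i, hi, hj⟩

end Independence

theorem exists_disjoint_powersetCard {m ℓ n : ℕ} (h : m * ℓ ≤ n) :
    ∃ B : Fin m → Set.powersetCard (Fin n) ℓ,
      Pairwise (Function.onFun Disjoint fun i => (B i : Finset (Fin n))) := by
  let e : Fin m × Fin ℓ ↪ Fin n := finProdFinEquiv.toEmbedding.trans (Fin.castLEEmb h)
  refine ⟨fun i => Set.powersetCard.ofFinEmb ℓ (Fin n)
    ⟨fun a => e (i, a), fun a b hab => by simpa using hab⟩, fun i j hij => ?_⟩
  simp only [Function.onFun, Finset.disjoint_left]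
  simp
  intro a b hab
  exact hij (by simpa using (congrArg Prod.fst (e.injective hab)).symm)

/-- Hoeffding's averaging argument: the exponential moment of a sum over all `ℓ`-subsets of
positions is bounded by that of a rescaled binomial variable with `m` disjoint blocks. -/
theorem expect_exp_sum_powersetCard_le {n ℓ m : ℕ} {α : Type*} [Fintype α] [Nonempty α]
    (hm : 0 < m) (h : m * ℓ ≤ n) (A : Set.powersetCard (Fin n) ℓ → (Fin n → α) → ℝ)
    (hA : ∀ S w, A S w = 0 ∨ A S w = 1) (hdep : ∀ S, DependsOn (A S) (S : Finset (Fin n)))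
    {p : ℝ} (hp : ∀ S, 𝔼 w, A S w = p) (s : ℝ) :
    𝔼 w, Real.exp (s * ∑ S, A S w) ≤
      (1 + p * (Real.exp (s * (n.choose ℓ / m)) - 1)) ^ m := by
  obtain ⟨B, hB⟩ := exists_disjoint_powersetCard h
  set c : ℝ := n.choose ℓ / m with hc
  have hm' : (m : ℝ) ≠ 0 := by exact_mod_cast hm.ne'
  have hK : Fintype.card (Set.powersetCard (Fin n) ℓ) = n.choose ℓ := by
    rw [← Nat.card_eq_fintype_card, Set.powersetCard.card]; simp
  have : MulAction.IsPretransitive (Equiv.Perm (Fin n)) (Set.powersetCard (Fin n) ℓ) :=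
    Set.powersetCard.isPretransitive
  have hK0 : (n.choose ℓ : ℝ) ≠ 0 := by
    have : ℓ ≤ n := le_trans (Nat.le_mul_of_pos_left ℓ hm) h
    exact_mod_cast (Nat.choose_pos this).ne'
  have havg : ∀ w, s * ∑ S, A S w =
      𝔼 g : Equiv.Perm (Fin n), s * c * ∑ i, A (g • B i) w := by
    intro w
    rw [← Finset.mul_expect, Finset.expect_sum_comm]
    simp_rw [expect_smul_eq_expect (G := Equiv.Perm (Fin n)) (fun S => A S w),
      Fintype.expect_eq_sum_div_card, hK]
    simp [hc]
    field_simp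
  have hone : ∀ S, 𝔼 w, Real.exp (s * c * A S w) = 1 + p * (Real.exp (s * c) - 1) := by
    intro S
    rw [← hp S, Finset.expect_mul]
    rw [← Fintype.expect_one (ι := Fin n → α) (M := ℝ), ← Finset.expect_add_distrib]
    refine Finset.expect_congr rfl fun w _ => ?_
    rcases hA S w with h | h <;> simp [h]
  calc 𝔼 w, Real.exp (s * ∑ S, A S w)
      ≤ 𝔼 w, 𝔼 g : Equiv.Perm (Fin n), Real.exp (s * c * ∑ i, A (g • B i) w) := by
        refine Finset.expect_le_expect fun w _ => ?_
        rw [havg]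
        exact exp_expect_le _
    _ = 𝔼 g : Equiv.Perm (Fin n), 𝔼 w, ∏ i, Real.exp (s * c * A (g • B i) w) := by
        rw [Finset.expect_comm]
        simp_rw [Finset.mul_sum, Real.exp_sum]
    _ = 𝔼 g : Equiv.Perm (Fin n), (1 + p * (Real.exp (s * c) - 1)) ^ m := by
        refine Finset.expect_congr rfl fun g _ => ?_
        rw [expect_prod_of_dependsOn Finset.univ (f := fun i w => Real.exp (s * c * A (g • B i) w))
          (s := fun i => ((g • B i : Set.powersetCard (Fin n) ℓ) : Finset (Fin n)))]
        · simp [hone]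
        · intro i j hij
          have := hB hij
          simp only [Function.onFun, Set.powersetCard.coe_smul] at this ⊢
          simpa [Finset.disjoint_iff_inter_eq_empty, ← Finset.smul_finset_inter] using this
        · intro i x y hxy
          simp only [hdep (g • B i) hxy]
    _ = _ := by simp

theorem bernoulli_mgf_le {p u : ℝ} (hp : 0 ≤ p) (hp1 : p ≤ 1) (hu : 0 ≤ u)
    (hu3 : u * (1 - p) < 3) :
    1 + p * (Real.exp u - 1) ≤
      Real.exp (u * p + p * (1 - p) * u ^ 2 / (2 * (1 - u * (1 - p) / 3))) := by
  have hq : 0 ≤ 1 - p := by linarith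
  set b : ℝ := 1 / (2 * (1 - u * (1 - p) / 3)) with hb
  have hd : 0 < 1 - u * (1 - p) / 3 := by linarith
  have hb2 : 1 / 2 ≤ b := by
    rw [hb]
    have : 0 ≤ u * (1 - p) := by positivity
    apply one_div_le_one_div_of_le <;> linarith
  have h1 : Real.exp (u * (1 - p)) ≤ 1 + u * (1 - p) + b * (u * (1 - p)) ^ 2 := by
    have := exp_le_bernstein (x := u * (1 - p)) (by positivity) hu3
    rw [hb, one_div_mul_eq_div]
    exact this
  have h2 : Real.exp (-(u * p)) ≤ 1 - u * p + b * (u * p) ^ 2 := by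
    have := exp_neg_le_quadratic (x := u * p) (by positivity)
    nlinarith [sq_nonneg (u * p)]
  have h3 : p * Real.exp (u * (1 - p)) + (1 - p) * Real.exp (-(u * p)) ≤
      Real.exp (b * u ^ 2 * (p * (1 - p))) := by
    refine le_trans ?_ (Real.add_one_le_exp _)
    have := add_le_add (mul_le_mul_of_nonneg_left h1 hp) (mul_le_mul_of_nonneg_left h2 hq)
    refine this.trans (le_of_eq ?_)
    ring
  have h4 : 1 + p * (Real.exp u - 1) = Real.exp (u * p) *
      (p * Real.exp (u * (1 - p)) + (1 - p) * Real.exp (-(u * p))) := by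
    rw [mul_add, mul_left_comm, mul_left_comm (Real.exp (u * p)), ← Real.exp_add, ← Real.exp_add]
    rw [show u * p + u * (1 - p) = u by ring, add_neg_cancel, Real.exp_zero]
    ring
  rw [h4, Real.exp_add]
  gcongr
  refine h3.trans (le_of_eq ?_)
  rw [hb]
  congr 1
  field_simp

theorem exp_le_one_add {r y : ℝ} (hr : 0 ≤ r) (hy : y ≤ 2 * r / (r + 2)) :
    Real.exp y ≤ 1 + r := by
  rw [← Real.le_log_iff_exp_le (by linarith)]
  exact hy.trans (Real.le_log_one_add_of_nonneg hr)

section Tails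
variable {Ω : Type*} [Fintype Ω]
open scoped Classical

theorem expect_indicator_le (P : Ω → Prop) (F : Ω → ℝ) (h0 : ∀ w, 0 ≤ F w)
    (h1 : ∀ w, P w → 1 ≤ F w) : 𝔼 w, (if P w then (1 : ℝ) else 0) ≤ 𝔼 w, F w := by
  refine Finset.expect_le_expect fun w _ => ?_
  split_ifs with h
  exacts [h1 w h, h0 w]

theorem upper_tail_of_mgf {X : Ω → ℝ} {c p t : ℝ} {m : ℕ} (hm : 0 < m) (hc : 0 < c) (hp : 0 < p)
    (hp1 : p < 1) (ht : 0 ≤ t)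
    (hX : ∀ s, 𝔼 w, Real.exp (s * X w) ≤ (1 + p * (Real.exp (s * c) - 1)) ^ m) :
    𝔼 w, (if m * c * p + t ≤ X w then (1 : ℝ) else 0) ≤
      Real.exp (-(t ^ 2 / (2 * c * (1 - p) * (m * c * p + t / 3)))) := by
  have hq : 0 < 1 - p := by linarith
  have hm' : (0 : ℝ) < m := by exact_mod_cast hm
  set D := m * c * p + t / 3 with hD
  have hD0 : 0 < D := by positivity
  set u := t / ((1 - p) * D) with hu
  have hu0 : 0 ≤ u := by positivity
  set s := u / c with hs
  have hs0 : 0 ≤ s := by positivity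
  have hsc : s * c = u := by rw [hs]; field_simp
  have huq : u * (1 - p) = t / D := by rw [hu]; field_simp
  have hu3 : u * (1 - p) < 3 := by
    rw [huq, div_lt_iff₀ hD0, hD]
    have : 0 < m * c * p := by positivity
    linarith
  calc _ ≤ 𝔼 w, Real.exp (s * X w) * Real.exp (-(s * (m * c * p + t))) := by
        refine expect_indicator_le _ _ (fun w => by positivity) fun w hw => ?_
        rw [← Real.exp_add]
        apply Real.one_le_exp
        nlinarith
    _ = (𝔼 w, Real.exp (s * X w)) * Real.exp (-(s * (m * c * p + t))) := by
        rw [Finset.expect_mul]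
    _ ≤ (Real.exp (u * p + p * (1 - p) * u ^ 2 / (2 * (1 - u * (1 - p) / 3)))) ^ m *
          Real.exp (-(s * (m * c * p + t))) := by
        gcongr
        refine (hX s).trans ?_
        rw [hsc]
        have := Real.exp_pos u
        gcongr
        · nlinarith
        · exact bernoulli_mgf_le hp.le hp1.le hu0 hu3
    _ = _ := by
        rw [← Real.exp_nat_mul, ← Real.exp_add]
        congr 1
        have h1 : 1 - u * (1 - p) / 3 = m * c * p / D := by
          rw [huq]; field_simp; rw [hD]; ring
        rw [h1, hs, hu]
        field_simp
        ring

theorem lower_tail_of_mgf {X : Ω → ℝ} {c p t : ℝ} {m : ℕ} (hm : 0 < m) (hc : 0 < c) (hp : 0 < p)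
    (hp1 : p < 1) (ht : 0 ≤ t)
    (hX : ∀ s, 𝔼 w, Real.exp (s * X w) ≤ (1 + p * (Real.exp (s * c) - 1)) ^ m) :
    𝔼 w, (if X w ≤ m * c * p - t then (1 : ℝ) else 0) ≤
      Real.exp (-(t ^ 2 / (2 * c * (m * c * p)))) := by
  have hm' : (0 : ℝ) < m := by exact_mod_cast hm
  set u := t / (m * c * p) with hu
  have hu0 : 0 ≤ u := by positivity
  set s := u / c with hs
  have hs0 : 0 ≤ s := by positivity
  have hsc : s * c = u := by rw [hs]; field_simp
  calc _ ≤ 𝔼 w, Real.exp (-s * X w) * Real.exp (s * (m * c * p - t)) := by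
        refine expect_indicator_le _ _ (fun w => by positivity) fun w hw => ?_
        rw [← Real.exp_add]
        apply Real.one_le_exp
        nlinarith
    _ = (𝔼 w, Real.exp (-s * X w)) * Real.exp (s * (m * c * p - t)) := by
        rw [Finset.expect_mul]
    _ ≤ (Real.exp (p * (-u + u ^ 2 / 2))) ^ m * Real.exp (s * (m * c * p - t)) := by
        gcongr
        refine (hX (-s)).trans ?_
        rw [neg_mul, hsc]
        have := Real.exp_pos (-u)
        gcongr
        · nlinarith
        · rw [add_comm]
          refine (Real.add_one_le_exp _).trans ?_
          gcongr
          have := exp_neg_le_quadratic hu0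
          linarith
    _ = _ := by
        rw [← Real.exp_nat_mul, ← Real.exp_add]
        congr 1
        rw [hs, hu]
        field_simp
        ring

theorem upper_tail_of_bounded {X : Ω → ℝ} {K c p t : ℝ} (hK : 0 < K) (hp : 0 < p) (hp1 : p < 1)
    (ht : 0 ≤ t) (hc : 3 * K ≤ 4 * c) (hX0 : ∀ w, 0 ≤ X w) (hXK : ∀ w, X w ≤ K)
    (hμ : 𝔼 w, X w = K * p) :
    𝔼 w, (if K * p + t ≤ X w then (1 : ℝ) else 0) ≤
      Real.exp (-(t ^ 2 / (2 * c * (1 - p) * (K * p + t / 3)))) := by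
  have hq : 0 < 1 - p := by linarith
  have hc0 : 0 < c := by linarith
  have hμ0 : 0 < K * p := by positivity
  rcases lt_or_ge (K * (1 - p)) t with h | h
  · refine (expect_indicator_le _ (fun _ => 0) (fun _ => le_rfl) fun w hw => ?_).trans ?_
    · have := hXK w; nlinarith
    · simp; positivity
  · calc _ ≤ 𝔼 w, X w / (K * p + t) := by
          refine expect_indicator_le _ _ (fun w => ?_) fun w hw => ?_
          · have := hX0 w; positivity
          · rwa [one_le_div (by positivity)]
      _ = (1 + t / (K * p))⁻¹ := by
          rw [← Finset.expect_div, hμ]; field_simp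
      _ ≤ _ := by
          rw [Real.exp_neg]
          gcongr
          apply exp_le_one_add (by positivity)
          calc t ^ 2 / (2 * c * (1 - p) * (K * p + t / 3))
              ≤ t * (K * (1 - p)) / (2 * (3 * K / 4) * (1 - p) * (K * p + t / 3)) := by
                rw [sq]; gcongr; linarith
            _ = 2 * t / (t + 3 * (K * p)) := by field_simp; ring
            _ ≤ 2 * t / (t + 2 * (K * p)) := by gcongr; norm_num
            _ = _ := by field_simp

theorem lower_tail_of_bounded {X : Ω → ℝ} {K c p t : ℝ} [Nonempty Ω]
    (hK : 0 < K) (hp : 0 < p) (hp1 : p < 1)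
    (ht : 0 ≤ t) (hc : 3 * K ≤ 4 * c) (hX0 : ∀ w, 0 ≤ X w) (hXK : ∀ w, X w ≤ K)
    (hμ : 𝔼 w, X w = K * p) :
    𝔼 w, (if X w ≤ K * p - t then (1 : ℝ) else 0) ≤
      Real.exp (-(t ^ 2 / (2 * c * (K * p)))) := by
  have hq : 0 < 1 - p := by linarith
  have hc0 : 0 < c := by linarith
  have hμ0 : 0 < K * p := by positivity
  rcases lt_or_ge (K * p) t with h | h
  · refine (expect_indicator_le _ (fun _ => 0) (fun _ => le_rfl) fun w hw => ?_).trans ?_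
    · have := hX0 w; linarith
    · simp; positivity
  · calc _ ≤ 𝔼 w, (K - X w) / (K * (1 - p) + t) := by
          refine expect_indicator_le _ _ (fun w => ?_) fun w hw => ?_
          · have := sub_nonneg.2 (hXK w); positivity
          · rw [one_le_div (by positivity)]; linarith
      _ = (1 + t / (K * (1 - p)))⁻¹ := by
          rw [← Finset.expect_div, Finset.expect_sub_distrib, hμ, Fintype.expect_const]; field_simp
      _ ≤ _ := by
          rw [Real.exp_neg]
          gcongr
          apply exp_le_one_add (by positivity)
          calc t ^ 2 / (2 * c * (K * p))
              ≤ t * (K * p) / (2 * (3 * K / 4) * (K * p)) := by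
                rw [sq]; gcongr; linarith
            _ = 2 * t / (3 * K) := by field_simp; ring
            _ ≤ 2 * t / (t + 2 * (K * (1 - p))) := by gcongr; nlinarith
            _ = _ := by field_simp

end Tails

theorem self_le_choose {n ℓ : ℕ} (hl : 0 < ℓ) (h : ℓ < n) : n ≤ n.choose ℓ := by
  induction n with
  | zero => omega
  | succ n ih =>
    obtain ⟨j, rfl⟩ : ∃ j, ℓ = j + 1 := ⟨ℓ - 1, by omega⟩
    rcases (Nat.lt_succ_iff.1 h).eq_or_lt with rfl | h'
    · simp
    · have := Nat.choose_pos (show j ≤ n by omega)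
      have := ih h'
      rw [Nat.choose_succ_succ']
      omega

theorem choose_two_le_choose {n ℓ : ℕ} (hl : 2 ≤ ℓ) (h : 2 * ℓ ≤ n) : n.choose 2 ≤ n.choose ℓ := by
  induction ℓ, hl using Nat.le_induction with
  | base => rfl
  | succ j hj ih => exact (ih (by omega)).trans (Nat.choose_le_succ_of_lt_half_left (by omega))

theorem mul_pred_mul_choose_sub_le {n ℓ : ℕ} (hl : 2 ≤ ℓ) (h : 2 * ℓ ≤ n) :
    n * (n - 1) * (n - ℓ).choose ℓ ≤ (n - ℓ) * (n - ℓ - 1) * n.choose ℓ := by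
  have key : ∀ N L : ℕ, (N + 2) * (N + 1) * N.choose L =
      (N + 2).choose (L + 2) * ((L + 2) * (L + 1)) := by
    intro N L
    have h1 := Nat.add_one_mul_choose_eq N L
    have h2 := Nat.add_one_mul_choose_eq (N + 1) (L + 1)
    calc _ = (N + 2) * ((N + 1) * N.choose L) := by ring
      _ = ((N + 1 + 1) * (N + 1).choose (L + 1)) * (L + 1) := by rw [h1]; ring
      _ = _ := by rw [h2]; ring
  obtain ⟨L, rfl⟩ := Nat.exists_eq_add_of_le' hl
  obtain ⟨M, hM⟩ : ∃ M, n - (L + 2) = M + 2 := ⟨n - (L + 2) - 2, by omega⟩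
  obtain ⟨N, rfl⟩ : ∃ N, n = N + 2 := ⟨n - 2, by omega⟩
  have h1 := key N L
  have h2 := key M L
  rw [hM]
  simp only [show N + 2 - 1 = N + 1 from rfl, show M + 2 - 1 = M + 1 from rfl]
  have h3 : M.choose L ≤ N.choose L := Nat.choose_le_choose L (by omega)
  have h4 : 0 < (L + 2) * (L + 1) := by positivity
  refine Nat.le_of_mul_le_mul_right ?_ h4
  calc (N + 2) * (N + 1) * (M + 2).choose (L + 2) * ((L + 2) * (L + 1))
      = (N + 2) * (N + 1) * ((M + 2) * (M + 1)) * M.choose L := by rw [mul_assoc, ← h2]; ring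
    _ ≤ (N + 2) * (N + 1) * ((M + 2) * (M + 1)) * N.choose L := by gcongr
    _ = _ := by rw [mul_assoc ((M + 2) * (M + 1)), ← h1]; ring

/-- With `m = ⌊n / ℓ⌋`, the scale `C(n, ℓ) / m` is controlled by the dependency degree
`C(n, ℓ) - C(n - ℓ, ℓ) - 1`. -/
theorem four_mul_choose_le {n ℓ m : ℕ} (hl : 2 ≤ ℓ) (hm : 2 ≤ m) (h1 : m * ℓ ≤ n)
    (h2 : n < (m + 1) * ℓ) :
    4 * (n.choose ℓ : ℝ) ≤ (4 * m + 1) * ((n.choose ℓ : ℝ) - ((n - ℓ).choose ℓ : ℝ) - 1) := by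
  have hn : 2 * ℓ ≤ n := le_trans (by gcongr) h1
  by_cases h4 : n = 4
  · obtain rfl : ℓ = 2 := by omega
    obtain rfl : m = 2 := by omega
    subst h4
    norm_num [Nat.choose]
  have hpred := mul_pred_mul_choose_sub_le hl hn
  have hC : ((m + 1 : ℝ)) ^ 2 * ((n - ℓ).choose ℓ : ℝ) ≤ (m : ℝ) ^ 2 * (n.choose ℓ : ℝ) := by
    have e1 : (m + 1) * (n - ℓ) ≤ m * n := by
      zify [show ℓ ≤ n by omega]
      zify at h2
      nlinarith
    have e2 : (m + 1) * (n - ℓ - 1) ≤ m * (n - 1) := by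
      have : (m + 1) * (n - ℓ) - (m + 1) ≤ m * n - m := by omega
      simpa [Nat.mul_sub] using this
    have hpos : 0 < n * (n - 1) := Nat.mul_pos (by omega) (by omega)
    have : (m + 1) ^ 2 * (n - ℓ).choose ℓ ≤ m ^ 2 * n.choose ℓ := by
      refine Nat.le_of_mul_le_mul_right ?_ hpos
      calc (m + 1) ^ 2 * (n - ℓ).choose ℓ * (n * (n - 1))
          = (m + 1) ^ 2 * (n * (n - 1) * (n - ℓ).choose ℓ) := by ring
        _ ≤ (m + 1) ^ 2 * ((n - ℓ) * (n - ℓ - 1) * n.choose ℓ) := by gcongr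
        _ = ((m + 1) * (n - ℓ)) * ((m + 1) * (n - ℓ - 1)) * n.choose ℓ := by ring
        _ ≤ (m * n) * (m * (n - 1)) * n.choose ℓ := by gcongr
        _ = _ := by ring
    exact_mod_cast this
  have hK2 : (n : ℝ) * (n - 1) ≤ 2 * (n.choose ℓ : ℝ) := by
    have : (n.choose 2 : ℝ) ≤ n.choose ℓ := by exact_mod_cast choose_two_le_choose hl hn
    rw [Nat.cast_choose_two] at this
    linarith
  have hmn : 2 * m ≤ n := by nlinarith
  have hmR : (2 : ℝ) ≤ m := by exact_mod_cast hm
  have hmain : (m + 1 : ℝ) ^ 2 * (4 * m + 1) ≤ (4 * m ^ 2 - 2 * m - 3) * n.choose ℓ := by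
    rcases hm.eq_or_lt with rfl | h3
    · have : (5 : ℝ) ≤ n := by exact_mod_cast (show 5 ≤ n by omega)
      push_cast
      nlinarith
    · have h3' : (3 : ℝ) ≤ m := by exact_mod_cast h3
      have hmn' : 2 * (m : ℝ) ≤ n := by exact_mod_cast hmn
      have hK : (m : ℝ) * (2 * m - 1) ≤ n.choose ℓ := by nlinarith
      have hcoef : (0 : ℝ) ≤ 4 * m ^ 2 - 2 * m - 3 := by nlinarith
      refine le_trans ?_ (mul_le_mul_of_nonneg_left hK hcoef)
      obtain ⟨x, hx, hx0⟩ : ∃ x : ℝ, (m : ℝ) = 3 + x ∧ 0 ≤ x := ⟨m - 3, by ring, by linarith⟩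
      rw [hx, ← sub_nonneg]
      ring_nf
      positivity
  have hsq : (0 : ℝ) < (m + 1) ^ 2 := by positivity
  refine le_of_mul_le_mul_left ?_ hsq
  nlinarith

/-- The subword of `w` at the positions in `S` is order-isomorphic to `v`. -/
def MatchesAt {k ℓ n : ℕ} (v : Fin ℓ → Fin k) (S : Set.powersetCard (Fin n) ℓ)
    (w : Fin n → Fin k) : Prop :=
  ∀ p q : Fin ℓ,
    (w (Set.powersetCard.ofFinEmbEquiv.symm S p) < w (Set.powersetCard.ofFinEmbEquiv.symm S q) ↔
      v p < v q) ∧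
    (w (Set.powersetCard.ofFinEmbEquiv.symm S p) = w (Set.powersetCard.ofFinEmbEquiv.symm S q) ↔
      v p = v q)

section Matches
open scoped Classical
variable {k ℓ n : ℕ} (v : Fin ℓ → Fin k)

theorem occ_eq_sum_matchesAt (w : Fin n → Fin k) :
    (occ k ℓ n v w : ℝ) =
      ∑ S : Set.powersetCard (Fin n) ℓ, if MatchesAt v S w then (1 : ℝ) else 0 := by
  have e : {j : Fin ℓ → Fin n // StrictMono j ∧
      ∀ p q : Fin ℓ, (w (j p) < w (j q) ↔ v p < v q) ∧ (w (j p) = w (j q) ↔ v p = v q)} ≃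
      {S : Set.powersetCard (Fin n) ℓ // MatchesAt v S w} :=
    { toFun := fun j => ⟨Set.powersetCard.ofFinEmbEquiv (OrderEmbedding.ofStrictMono j.1 j.2.1), by
        simpa [MatchesAt] using j.2.2⟩
      invFun := fun S => ⟨Set.powersetCard.ofFinEmbEquiv.symm S.1,
        (Set.powersetCard.ofFinEmbEquiv.symm S.1).strictMono, S.2⟩
      left_inv := fun j => by simp
      right_inv := fun S => by
        apply Subtype.ext
        rw [← Equiv.eq_symm_apply]
        ext
        simp }
  rw [occ, Nat.card_congr e, Nat.card_eq_fintype_card, Fintype.card_subtype]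
  simp

theorem dependsOn_matchesAt (S : Set.powersetCard (Fin n) ℓ) :
    DependsOn (fun w : Fin n → Fin k => if MatchesAt v S w then (1 : ℝ) else 0)
      (S : Finset (Fin n)) := by
  intro x y hxy
  have h : ∀ p, x (Set.powersetCard.ofFinEmbEquiv.symm S p) =
      y (Set.powersetCard.ofFinEmbEquiv.symm S p) := fun p =>
    hxy _ ((Set.powersetCard.mem_range_ofFinEmbEquiv_symm_iff_mem S _).1 ⟨p, rfl⟩)
  have : MatchesAt v S x ↔ MatchesAt v S y := by simp [MatchesAt, h]
  simp only [this]

theorem expect_matchesAt_eq (S T : Set.powersetCard (Fin n) ℓ) :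
    𝔼 w : Fin n → Fin k, (if MatchesAt v S w then (1 : ℝ) else 0) =
      𝔼 w : Fin n → Fin k, if MatchesAt v T w then (1 : ℝ) else 0 := by
  have := Equiv.Perm.isMultiplyPretransitive (Fin n) ℓ
  obtain ⟨τ, hτ⟩ := MulAction.exists_smul_eq (Equiv.Perm (Fin n))
    (Set.powersetCard.ofFinEmbEquiv.symm T).toEmbedding
    (Set.powersetCard.ofFinEmbEquiv.symm S).toEmbedding
  have h : ∀ p, τ (Set.powersetCard.ofFinEmbEquiv.symm T p) =
      Set.powersetCard.ofFinEmbEquiv.symm S p := fun p => DFunLike.congr_fun hτ p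
  refine Fintype.expect_equiv (Equiv.arrowCongr τ.symm (Equiv.refl (Fin k))) _ _ fun w => if_congr ?_ rfl rfl
  simp [MatchesAt, h]

theorem expect_matchesAt_pos (hl : 0 < ℓ) (S : Set.powersetCard (Fin n) ℓ) :
    0 < 𝔼 w : Fin n → Fin k, (if MatchesAt v S w then (1 : ℝ) else 0) := by
  refine Finset.expect_pos' (fun w _ => by positivity)
    ⟨Function.extend (Set.powersetCard.ofFinEmbEquiv.symm S) v fun _ => v ⟨0, hl⟩,
      Finset.mem_univ _, ?_⟩
  have h := (Set.powersetCard.ofFinEmbEquiv.symm S).injective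
  rw [if_pos (by simp [MatchesAt, h.extend_apply])]
  exact one_pos

theorem expect_matchesAt_lt_one (hk : 2 ≤ k) (hl : 2 ≤ ℓ) (S : Set.powersetCard (Fin n) ℓ) :
    𝔼 w : Fin n → Fin k, (if MatchesAt v S w then (1 : ℝ) else 0) < 1 := by
  suffices h : ∃ w : Fin n → Fin k, ¬ MatchesAt v S w by
    obtain ⟨w, hw⟩ := h
    refine Finset.expect_lt (fun w _ => by split_ifs <;> norm_num) ⟨w, Finset.mem_univ _, ?_⟩
    simp [hw]
  by_contra! h
  let a : Fin ℓ := ⟨0, by omega⟩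
  let b : Fin ℓ := ⟨1, by omega⟩
  have hab : a ≠ b := by simp [a, b]
  let x : Fin k := ⟨0, by omega⟩
  let y : Fin k := ⟨1, by omega⟩
  have hxy : y ≠ x := by simp [x, y]
  have h1 := (h (fun _ => x) a b).2
  have h2 := (h (fun i => if i = Set.powersetCard.ofFinEmbEquiv.symm S a then x else y) b a).2
  have h3 : v a = v b := by simpa using h1
  simp [h3, hab.symm, hxy] at h2

end Matches

section Main
open scoped Classical
variable {k ℓ n : ℕ}

theorem card_div_pow_eq_expect (P : (Fin n → Fin k) → Prop) [DecidablePred P] :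
    (Nat.card {w : Fin n → Fin k // P w} : ℝ) / (k : ℝ) ^ n = 𝔼 w, if P w then (1 : ℝ) else 0 := by
  rw [Fintype.expect_eq_sum_div_card, Nat.card_eq_fintype_card, Fintype.card_subtype]
  simp

theorem muX_eq_expect (v : Fin ℓ → Fin k) : muX k ℓ v n = 𝔼 w, (occ k ℓ n v w : ℝ) := by
  rw [Fintype.expect_eq_sum_div_card, muX]
  simp

/-- The probability that a given `ℓ`-subset of positions carries the pattern, together with the
facts about `occ` needed for the tail bounds. -/
theorem exists_occurrence_probability (hk : 2 ≤ k) (hl : 2 ≤ ℓ) (hn : ℓ ≤ n) (v : Fin ℓ → Fin k) :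
    ∃ p : ℝ, 0 < p ∧ p < 1 ∧ muX k ℓ v n = n.choose ℓ * p ∧
      (∀ w, (occ k ℓ n v w : ℝ) ≤ n.choose ℓ) ∧
      ∀ m : ℕ, 0 < m → m * ℓ ≤ n → ∀ s : ℝ, 𝔼 w, Real.exp (s * occ k ℓ n v w) ≤
        (1 + p * (Real.exp (s * (n.choose ℓ / m)) - 1)) ^ m := by
  have : Nonempty (Fin k) := ⟨⟨0, by omega⟩⟩
  have hK : Fintype.card (Set.powersetCard (Fin n) ℓ) = n.choose ℓ := by
    rw [← Nat.card_eq_fintype_card, Set.powersetCard.card]; simp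
  obtain ⟨S⟩ : Nonempty (Set.powersetCard (Fin n) ℓ) := by
    rw [← Fintype.card_pos_iff, hK]
    exact Nat.choose_pos hn
  refine ⟨_, expect_matchesAt_pos v (by omega) S, expect_matchesAt_lt_one v hk hl S, ?_, ?_, ?_⟩
  · simp_rw [muX_eq_expect, occ_eq_sum_matchesAt, Finset.expect_sum_comm,
      fun T => expect_matchesAt_eq v T S]
    simp [hK]
  · intro w
    rw [occ_eq_sum_matchesAt]
    calc _ ≤ ∑ _S : Set.powersetCard (Fin n) ℓ, (1 : ℝ) :=
          Finset.sum_le_sum fun _ _ => by split_ifs <;> norm_num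
      _ = _ := by simp [hK]
  · intro m hm hmn s
    simp_rw [occ_eq_sum_matchesAt]
    refine expect_exp_sum_powersetCard_le hm hmn
      (fun S w => if MatchesAt v S w then (1 : ℝ) else 0) (fun S w => ?_) (dependsOn_matchesAt v)
      (fun T => expect_matchesAt_eq v T S) s
    split_ifs <;> simp

/-- Bernstein-type tail bounds for `occ` at any sufficiently large scale `C`. -/
theorem occ_tail_le (hk : 2 ≤ k) (hl : 2 ≤ ℓ) (hn : ℓ < n) (v : Fin ℓ → Fin k)
    {t C : ℝ} (ht : 0 ≤ t) (hsmall : n < 2 * ℓ → 3 * (n.choose ℓ : ℝ) ≤ 4 * C)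
    (hlarge : 2 * ℓ ≤ n → (n.choose ℓ : ℝ) / (n / ℓ : ℕ) ≤ C) :
    𝔼 w, (if muX k ℓ v n + t ≤ occ k ℓ n v w then (1 : ℝ) else 0) ≤
      Real.exp (-(t ^ 2 / (2 * C * (1 - muX k ℓ v n / n.choose ℓ) * (muX k ℓ v n + t / 3)))) ∧
    𝔼 w, (if (occ k ℓ n v w : ℝ) ≤ muX k ℓ v n - t then (1 : ℝ) else 0) ≤
      Real.exp (-(t ^ 2 / (2 * C * muX k ℓ v n))) := by
  have : Nonempty (Fin k) := ⟨⟨0, by omega⟩⟩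
  obtain ⟨p, hp, hp1, hμ, hocc, hmgf⟩ := exists_occurrence_probability hk hl hn.le v
  have hK : (0 : ℝ) < n.choose ℓ := by exact_mod_cast Nat.choose_pos hn.le
  have hE := muX_eq_expect (n := n) v
  have hq : 0 < 1 - p := by linarith
  have hdiv : muX k ℓ v n / n.choose ℓ = p := by rw [hμ]; field_simp
  rw [hμ] at hE
  rw [hdiv, hμ]
  rcases lt_or_ge n (2 * ℓ) with h | h
  · exact ⟨upper_tail_of_bounded hK hp hp1 ht (hsmall h) (fun _ => by positivity) hocc hE.symm,
      lower_tail_of_bounded hK hp hp1 ht (hsmall h) (fun _ => by positivity) hocc hE.symm⟩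
  · have hm : 0 < n / ℓ := Nat.div_pos hn.le (by omega)
    have hm' : (0 : ℝ) < (n / ℓ : ℕ) := by exact_mod_cast hm
    have hc : 0 < (n.choose ℓ : ℝ) / (n / ℓ : ℕ) := by positivity
    have hC := hlarge h
    have hX := hmgf _ hm (Nat.div_mul_le_self n ℓ)
    have e : ((n / ℓ : ℕ) : ℝ) * ((n.choose ℓ : ℝ) / (n / ℓ : ℕ)) * p = n.choose ℓ * p := by
      field_simp
    have hu := upper_tail_of_mgf hm hc hp hp1 ht hX
    have hd := lower_tail_of_mgf hm hc hp hp1 ht hX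
    rw [e] at hu hd
    refine ⟨hu.trans ?_, hd.trans ?_⟩ <;> gcongr

end Main

/-- Chernoff-type large deviation bounds (Corollary): with `K_n = C(n,ℓ)` and
`Δ_n = C(n,ℓ) - C(n-ℓ,ℓ) - 1`, for every `t ≥ 0`,
`P(X_n ≥ μ_n + t)` and `P(X_n ≤ μ_n - t)` satisfy the stated exponential bounds. -/
theorem chernoff_bounds (k ℓ : ℕ) (hk : 2 ≤ k) (hl : 2 ≤ ℓ)
    (v : Fin ℓ → Fin k) (n : ℕ) (hn : ℓ < n) (t : ℝ) (ht : 0 ≤ t) :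
    (Nat.card {w : Fin n → Fin k // muX k ℓ v n + t ≤ (occ k ℓ n v w : ℝ)} : ℝ)
        / (k : ℝ) ^ n
      ≤ Real.exp (-(t ^ 2 * (1 - ((n.choose ℓ : ℝ) - ((n - ℓ).choose ℓ : ℝ) - 1)
              / (4 * (n.choose ℓ : ℝ))))
          / (2 * ((n.choose ℓ : ℝ) - ((n - ℓ).choose ℓ : ℝ) - 1)
              * (muX k ℓ v n + t / 3) * (1 - muX k ℓ v n / (n.choose ℓ : ℝ)))) ∧
    (Nat.card {w : Fin n → Fin k // (occ k ℓ n v w : ℝ) ≤ muX k ℓ v n - t} : ℝ)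
        / (k : ℝ) ^ n
      ≤ Real.exp (-(t ^ 2 * (1 - ((n.choose ℓ : ℝ) - ((n - ℓ).choose ℓ : ℝ) - 1)
              / (4 * (n.choose ℓ : ℝ))))
          / (2 * ((n.choose ℓ : ℝ) - ((n - ℓ).choose ℓ : ℝ) - 1) * muX k ℓ v n)) := by
  have hK : (0 : ℝ) < n.choose ℓ := by exact_mod_cast Nat.choose_pos hn.le
  have hK3 : (3 : ℝ) ≤ n.choose ℓ := by
    exact_mod_cast (show 3 ≤ n by omega).trans (self_le_choose (by omega) hn)
  set K : ℝ := (n.choose ℓ : ℝ)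
  set Δ : ℝ := K - ((n - ℓ).choose ℓ : ℝ) - 1 with hΔ
  have hΔK : Δ ≤ K := by
    have : (0 : ℝ) ≤ (n - ℓ).choose ℓ := by positivity
    linarith
  have hfac : 0 < 1 - Δ / (4 * K) := by
    rw [sub_pos, div_lt_one (by positivity)]
    linarith
  have hfacK : (1 - Δ / (4 * K)) * (4 * K) = 4 * K - Δ := by field_simp
  have hsmall : n < 2 * ℓ → 3 * K ≤ 4 * (Δ / (1 - Δ / (4 * K))) := by
    intro h
    have h0 : (n - ℓ).choose ℓ = 0 := Nat.choose_eq_zero_of_lt (by omega)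
    have hΔ1 : Δ = K - 1 := by rw [hΔ, h0]; simp
    rw [← mul_div_assoc, le_div_iff₀ hfac]
    nlinarith
  have hlarge : 2 * ℓ ≤ n → K / (n / ℓ : ℕ) ≤ Δ / (1 - Δ / (4 * K)) := by
    intro h
    have hm : 2 ≤ n / ℓ := (Nat.le_div_iff_mul_le (by omega)).2 h
    have hm' : (0 : ℝ) < (n / ℓ : ℕ) := by exact_mod_cast (by omega : 0 < n / ℓ)
    have := four_mul_choose_le hl hm (Nat.div_mul_le_self n ℓ)
      (Nat.lt_mul_of_div_lt (Nat.lt_succ_self _) (by omega))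
    rw [div_le_div_iff₀ hm' hfac]
    linarith
  obtain ⟨hu, hd⟩ := occ_tail_le hk hl hn v ht hsmall hlarge
  classical
  rw [card_div_pow_eq_expect, card_div_pow_eq_expect]
  refine ⟨(le_of_eq ?_).trans (hu.trans (le_of_eq ?_)),
    (le_of_eq ?_).trans (hd.trans (le_of_eq ?_))⟩
  · exact Finset.expect_congr rfl fun w _ => if_congr Iff.rfl rfl rfl
  · rw [neg_div]
    congr 2
    rw [mul_div_assoc', div_mul_eq_mul_div, div_mul_eq_mul_div, div_div_eq_mul_div]
    congr 1
    ring
  · exact Finset.expect_congr rfl fun w _ => if_congr Iff.rfl rfl rfl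
  · rw [neg_div]
    congr 2
    rw [mul_div_assoc', div_mul_eq_mul_div, div_div_eq_mul_div]
end

section
/- Let μ_n = E(X_n) and let (θ_n)_{n∈ℕ} be a sequence of positive reals such that θ_n → ∞ and μ_n/θ_n → γ for some γ ∈ [0,∞). Then for every t ∈ ℝ: lim_{n→∞} (θ_n/μ_n)·log E(e^{t·X_n/θ_n}) = t, and lim_{n→∞} (θ_n/μ_n)·log E((1 + t/θ_n)^{X_n}) = t. -/
open Filter Topology

open Finset in
/-- Composing with an injection pushes the uniform distribution on words forward to the uniform
distribution on shorter words. -/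
lemma sum_comp_injective_mul {ι κ α : Type*} [Fintype ι] [Fintype κ] [Fintype α]
    [DecidableEq ι] [DecidableEq κ] {e : ι → κ} (he : Function.Injective e)
    (F : (ι → α) → ℝ) :
    (∑ w : κ → α, F (w ∘ e)) * (Fintype.card α : ℝ) ^ Fintype.card ι =
      (∑ u, F u) * (Fintype.card α : ℝ) ^ Fintype.card κ := by
  classical
  let E := Equiv.piEquivPiSubtypeProd (fun x => x ∈ Set.range e) (fun _ : κ => α)
  let R : (ι → α) ≃ ({x // x ∈ Set.range e} → α) :=
    Equiv.arrowCongr (Equiv.ofInjective e he) (Equiv.refl α)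
  have h1 : ∑ w : κ → α, F (w ∘ e) = ∑ p : ({x // x ∈ Set.range e} → α) ×
      ({x // ¬ x ∈ Set.range e} → α), F (R.symm p.1) := by
    refine Fintype.sum_equiv E _ _ fun w => ?_
    rfl
  have h2 : ∑ u, F u = ∑ u, F (R.symm u) := (Equiv.sum_comp R.symm F).symm
  have h3 : Fintype.card {x // ¬ x ∈ Set.range e} + Fintype.card ι = Fintype.card κ := by
    have := Fintype.card_subtype_compl (fun x => x ∈ Set.range e)
    have h5 := Fintype.card_subtype_le (fun x => x ∈ Set.range e)
    have h6 : Fintype.card {x // x ∈ Set.range e} = Fintype.card ι :=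
      (Fintype.card_congr (Equiv.ofInjective e he)).symm
    omega
  rw [h1, h2, Fintype.sum_prod_type]
  simp only [sum_const, card_univ, nsmul_eq_mul, ← mul_sum]
  rw [← h3, Fintype.card_fun, pow_add]
  push_cast
  ring

open Classical in
/-- The indicator that the word `u` is order-isomorphic to the pattern `v`. -/
noncomputable def patternIndicator {k ℓ : ℕ} (v u : Fin ℓ → Fin k) : ℝ :=
  if ∀ p q : Fin ℓ, (u p < u q ↔ v p < v q) ∧ (u p = u q ↔ v p = v q) then 1 else 0

lemma patternIndicator_nonneg {k ℓ : ℕ} (v u : Fin ℓ → Fin k) : 0 ≤ patternIndicator v u := by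
  unfold patternIndicator; split_ifs <;> simp

lemma patternIndicator_le_one {k ℓ : ℕ} (v u : Fin ℓ → Fin k) : patternIndicator v u ≤ 1 := by
  unfold patternIndicator; split_ifs <;> simp

lemma patternIndicator_self {k ℓ : ℕ} (v : Fin ℓ → Fin k) : patternIndicator v v = 1 := by
  simp [patternIndicator]

/-- The probability that a uniform word of length `ℓ` is order-isomorphic to `v`. -/
noncomputable def patternProb {k ℓ : ℕ} (v : Fin ℓ → Fin k) : ℝ :=
  (∑ u, patternIndicator v u) / (k : ℝ) ^ ℓ

lemma patternProb_pos {k ℓ : ℕ} (hk : 1 ≤ k) (v : Fin ℓ → Fin k) : 0 < patternProb v := by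
  have hk' : (0 : ℝ) < k := by exact_mod_cast hk
  refine div_pos (Finset.sum_pos' (fun u _ => patternIndicator_nonneg v u)
    ⟨v, Finset.mem_univ v, ?_⟩) (by positivity)
  simp [patternIndicator_self]

open Classical in
/-- The increasing index tuples of length `ℓ` in `Fin n`. -/
noncomputable def increasingTuples (ℓ n : ℕ) : Finset (Fin ℓ → Fin n) :=
  Finset.univ.filter StrictMono

lemma mem_increasingTuples {ℓ n : ℕ} {j : Fin ℓ → Fin n} :
    j ∈ increasingTuples ℓ n ↔ StrictMono j := by
  simp [increasingTuples]

lemma card_increasingTuples (ℓ n : ℕ) : (increasingTuples ℓ n).card = n.choose ℓ := by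
  classical
  have e1 : {j // j ∈ increasingTuples ℓ n} ≃ (Fin ℓ ↪o Fin n) :=
    { toFun := fun j => OrderEmbedding.ofStrictMono j.1 (mem_increasingTuples.1 j.2)
      invFun := fun f => ⟨f, mem_increasingTuples.2 f.strictMono⟩
      left_inv := fun j => rfl
      right_inv := fun f => by ext; rfl }
  have h := Nat.card_congr (e1.trans Set.powersetCard.ofFinEmbEquiv)
  rw [Set.powersetCard.card] at h
  simpa using h

lemma occ_eq_sum {k ℓ n : ℕ} (v : Fin ℓ → Fin k) (w : Fin n → Fin k) :
    (occ k ℓ n v w : ℝ) = ∑ j ∈ increasingTuples ℓ n, patternIndicator v (w ∘ j) := by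
  classical
  unfold occ patternIndicator increasingTuples
  rw [Finset.sum_boole, Finset.filter_filter, Nat.card_eq_fintype_card, Fintype.card_subtype]
  rfl

lemma sum_patternIndicator_comp {k ℓ n : ℕ} (hk : 1 ≤ k) (v : Fin ℓ → Fin k)
    {j : Fin ℓ → Fin n} (hj : Function.Injective j) :
    ∑ w : Fin n → Fin k, patternIndicator v (w ∘ j) = patternProb v * (k : ℝ) ^ n := by
  have hk' : (0 : ℝ) < k := by exact_mod_cast hk
  have h := sum_comp_injective_mul hj (patternIndicator v)
  simp only [Fintype.card_fin] at h
  unfold patternProb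
  field_simp
  linarith

lemma sum_patternIndicator_mul_of_disjoint {k ℓ n : ℕ} (hk : 1 ≤ k) (v : Fin ℓ → Fin k)
    {i j : Fin ℓ → Fin n} (hi : Function.Injective i) (hj : Function.Injective j)
    (hij : ∀ a b, i a ≠ j b) :
    ∑ w : Fin n → Fin k, patternIndicator v (w ∘ i) * patternIndicator v (w ∘ j) =
      patternProb v ^ 2 * (k : ℝ) ^ n := by
  have hk' : (0 : ℝ) < k := by exact_mod_cast hk
  have h := sum_comp_injective_mul (hi.sumElim hj hij)
    (fun u : Fin ℓ ⊕ Fin ℓ → Fin k =>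
      patternIndicator v (u ∘ Sum.inl) * patternIndicator v (u ∘ Sum.inr))
  have h2 : ∑ u : Fin ℓ ⊕ Fin ℓ → Fin k,
      patternIndicator v (u ∘ Sum.inl) * patternIndicator v (u ∘ Sum.inr) =
      (∑ u, patternIndicator v u) ^ 2 := by
    rw [Fintype.sum_equiv (Equiv.sumArrowEquivProdArrow (Fin ℓ) (Fin ℓ) (Fin k))
      (fun u => patternIndicator v (u ∘ Sum.inl) * patternIndicator v (u ∘ Sum.inr))
      (fun p => patternIndicator v p.1 * patternIndicator v p.2) (fun u => rfl),
      Fintype.sum_prod_type, sq, Finset.sum_mul_sum]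
  rw [h2] at h
  simp only [Function.comp_assoc, Sum.elim_comp_inl, Sum.elim_comp_inr, Fintype.card_fin,
    Fintype.card_sum] at h
  unfold patternProb
  field_simp
  rw [← h, ← pow_mul, mul_two]

lemma muX_eq {k ℓ : ℕ} (hk : 1 ≤ k) (v : Fin ℓ → Fin k) (n : ℕ) :
    muX k ℓ v n = patternProb v * n.choose ℓ := by
  have hk' : (0 : ℝ) < k := by exact_mod_cast hk
  unfold muX
  simp only [occ_eq_sum]
  rw [Finset.sum_comm, Finset.sum_congr rfl fun j hj =>
    sum_patternIndicator_comp hk v (mem_increasingTuples.1 hj).injective]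
  rw [Finset.sum_const, card_increasingTuples, nsmul_eq_mul]
  field_simp

lemma card_apply_eq_mul (ℓ n : ℕ) (b : Fin ℓ) (x : Fin n) :
    ((Finset.univ.filter fun j : Fin ℓ → Fin n => j b = x).card : ℝ) * n = (n : ℝ) ^ ℓ := by
  have h := sum_comp_injective_mul (e := fun _ : Unit => b) (Function.injective_of_subsingleton _)
    (fun u : Unit → Fin n => if u () = x then (1 : ℝ) else 0)
  have h2 : ∑ u : Unit → Fin n, (if u () = x then (1 : ℝ) else 0) = 1 := by
    rw [Fintype.sum_equiv (Equiv.funUnique Unit (Fin n))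
      (fun u => if u () = x then (1 : ℝ) else 0)
      (fun y => if y = x then (1 : ℝ) else 0) (fun u => rfl)]
    simp
  rw [h2] at h
  simpa [Finset.sum_boole] using h

open Classical in
lemma card_intersecting_pairs_mul_le (ℓ n : ℕ) :
    (∑ i ∈ increasingTuples ℓ n, ∑ j ∈ increasingTuples ℓ n,
      if ∃ a b, i a = j b then (1 : ℝ) else 0) * n ≤ (ℓ : ℝ) ^ 2 * ((n : ℝ) ^ ℓ) ^ 2 := by
  have h1 : ∀ i : Fin ℓ → Fin n,
      (∑ j : Fin ℓ → Fin n, if ∃ a b, i a = j b then (1 : ℝ) else 0) * n ≤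
        (ℓ : ℝ) ^ 2 * (n : ℝ) ^ ℓ := by
    intro i
    have h2 : ∑ j : Fin ℓ → Fin n, (if ∃ a b, i a = j b then (1 : ℝ) else 0) ≤
        ∑ a : Fin ℓ, ∑ b : Fin ℓ, ∑ j : Fin ℓ → Fin n, if j b = i a then (1 : ℝ) else 0 := by
      rw [Finset.sum_congr rfl fun a _ => Finset.sum_comm, Finset.sum_comm]
      refine Finset.sum_le_sum fun j _ => ?_
      split_ifs with h
      · obtain ⟨a, b, hab⟩ := h
        have h0 : ∀ a b, (0 : ℝ) ≤ if j b = i a then (1 : ℝ) else 0 := fun a b => by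
          split_ifs <;> simp
        calc (1 : ℝ) = if j b = i a then (1 : ℝ) else 0 := by rw [if_pos hab.symm]
          _ ≤ ∑ b, if j b = i a then (1 : ℝ) else 0 :=
            Finset.single_le_sum (f := fun b => if j b = i a then (1 : ℝ) else 0)
              (fun b _ => h0 a b) (Finset.mem_univ b)
          _ ≤ _ := Finset.single_le_sum
              (f := fun a => ∑ b, if j b = i a then (1 : ℝ) else 0)
              (fun a _ => Finset.sum_nonneg fun b _ => h0 a b) (Finset.mem_univ a)
      · exact Finset.sum_nonneg fun a _ => Finset.sum_nonneg fun b _ => by split_ifs <;> simp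
    refine (mul_le_mul_of_nonneg_right h2 (Nat.cast_nonneg n)).trans (le_of_eq ?_)
    simp only [Finset.sum_boole, Finset.sum_mul]
    rw [Finset.sum_congr rfl fun a _ => Finset.sum_congr rfl fun b _ =>
      card_apply_eq_mul ℓ n b (i a)]
    simp
    ring
  have hf : ∀ i j : Fin ℓ → Fin n, (0 : ℝ) ≤ if ∃ a b, i a = j b then (1 : ℝ) else 0 :=
    fun i j => by split_ifs <;> simp
  calc _ ≤ (∑ i : Fin ℓ → Fin n, ∑ j : Fin ℓ → Fin n,
        if ∃ a b, i a = j b then (1 : ℝ) else 0) * n := by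
        refine mul_le_mul_of_nonneg_right ?_ (Nat.cast_nonneg n)
        refine (Finset.sum_le_sum fun i _ => Finset.sum_le_sum_of_subset_of_nonneg
          (Finset.subset_univ _) fun j _ _ => hf i j).trans ?_
        exact Finset.sum_le_sum_of_subset_of_nonneg (Finset.subset_univ _)
          fun i _ _ => Finset.sum_nonneg fun j _ => hf i j
    _ ≤ ∑ i : Fin ℓ → Fin n, (ℓ : ℝ) ^ 2 * (n : ℝ) ^ ℓ := by
        rw [Finset.sum_mul]
        exact Finset.sum_le_sum fun i _ => h1 i
    _ = _ := by simp; ring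

lemma varX_mul_le {k ℓ : ℕ} (hk : 1 ≤ k) (v : Fin ℓ → Fin k) (n : ℕ) :
    varX k ℓ v n * n ≤ (ℓ : ℝ) ^ 2 * ((n : ℝ) ^ ℓ) ^ 2 := by
  classical
  have hk' : (0 : ℝ) < k := by exact_mod_cast hk
  refine le_trans (mul_le_mul_of_nonneg_right ?_ (Nat.cast_nonneg n))
    (card_intersecting_pairs_mul_le ℓ n)
  unfold varX
  rw [div_le_iff₀ (by positivity)]
  have h1 : ∀ w : Fin n → Fin k, ((occ k ℓ n v w : ℝ) - muX k ℓ v n) ^ 2 =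
      ∑ i ∈ increasingTuples ℓ n, ∑ j ∈ increasingTuples ℓ n,
        (patternIndicator v (w ∘ i) - patternProb v) *
          (patternIndicator v (w ∘ j) - patternProb v) := by
    intro w
    rw [← Finset.sum_mul_sum, ← sq, Finset.sum_sub_distrib, ← occ_eq_sum, Finset.sum_const,
      card_increasingTuples, nsmul_eq_mul, muX_eq hk]
    ring
  simp only [h1]
  rw [Finset.sum_comm, Finset.sum_mul]
  refine Finset.sum_le_sum fun i hi => ?_
  rw [Finset.sum_comm, Finset.sum_mul]
  refine Finset.sum_le_sum fun j hj => ?_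
  have hi' := (mem_increasingTuples.1 hi).injective
  have hj' := (mem_increasingTuples.1 hj).injective
  have hc : ∑ w : Fin n → Fin k, (1 : ℝ) = (k : ℝ) ^ n := by simp
  have h2 : ∑ w : Fin n → Fin k, (patternIndicator v (w ∘ i) - patternProb v) *
      (patternIndicator v (w ∘ j) - patternProb v) =
      ∑ w : Fin n → Fin k, patternIndicator v (w ∘ i) * patternIndicator v (w ∘ j) -
        patternProb v ^ 2 * (k : ℝ) ^ n := by
    have : ∀ w : Fin n → Fin k, (patternIndicator v (w ∘ i) - patternProb v) *
      (patternIndicator v (w ∘ j) - patternProb v) =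
        patternIndicator v (w ∘ i) * patternIndicator v (w ∘ j) -
        patternProb v * patternIndicator v (w ∘ i) -
        patternProb v * patternIndicator v (w ∘ j) + patternProb v ^ 2 * 1 := fun w => by ring
    simp only [this]
    rw [Finset.sum_add_distrib, Finset.sum_sub_distrib, Finset.sum_sub_distrib, ← Finset.mul_sum,
      ← Finset.mul_sum, ← Finset.mul_sum, sum_patternIndicator_comp hk v hi',
      sum_patternIndicator_comp hk v hj', hc]
    ring
  rw [h2]
  split_ifs with h
  · have h3 : ∑ w : Fin n → Fin k, patternIndicator v (w ∘ i) * patternIndicator v (w ∘ j) ≤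
        ∑ w : Fin n → Fin k, (1 : ℝ) :=
      Finset.sum_le_sum fun w _ => mul_le_one₀ (patternIndicator_le_one _ _)
        (patternIndicator_nonneg _ _) (patternIndicator_le_one _ _)
    have : 0 ≤ patternProb v ^ 2 * (k : ℝ) ^ n := by positivity
    linarith
  · push Not at h
    rw [sum_patternIndicator_mul_of_disjoint hk v hi' hj' h]
    simp

lemma occ_le_choose {k ℓ n : ℕ} (v : Fin ℓ → Fin k) (w : Fin n → Fin k) :
    (occ k ℓ n v w : ℝ) ≤ n.choose ℓ := by
  rw [occ_eq_sum, ← card_increasingTuples, Finset.card_eq_sum_ones]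
  push_cast
  exact Finset.sum_le_sum fun j _ => patternIndicator_le_one _ _

lemma pow_le_mul_choose {ℓ n : ℕ} (h : 2 * ℓ ≤ n) :
    (n : ℝ) ^ ℓ ≤ 2 ^ ℓ * ℓ.factorial * n.choose ℓ := by
  have h1 := Nat.pow_le_choose (α := ℝ) ℓ n
  have h2 : (n : ℝ) ≤ 2 * ((n + 1 - ℓ : ℕ) : ℝ) := by
    have : n ≤ 2 * (n + 1 - ℓ) := by omega
    exact_mod_cast this
  have h3 : (n : ℝ) ^ ℓ ≤ (2 * ((n + 1 - ℓ : ℕ) : ℝ)) ^ ℓ :=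
    pow_le_pow_left₀ (Nat.cast_nonneg n) h2 ℓ
  rw [div_le_iff₀ (by exact_mod_cast ℓ.factorial_pos)] at h1
  rw [mul_pow] at h3
  calc (n : ℝ) ^ ℓ ≤ _ := h3
    _ ≤ 2 ^ ℓ * (n.choose ℓ * ℓ.factorial) := by gcongr
    _ = _ := by ring

lemma exp_le_one_add_add_sq_mul_exp {x B : ℝ} (hx : |x| ≤ B) :
    Real.exp x ≤ 1 + x + x ^ 2 * Real.exp B := by
  have h := Complex.norm_exp_sub_sum_le_norm_mul_exp (x : ℂ) 2
  simp only [Finset.sum_range_succ, Finset.sum_range_zero] at h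
  norm_num at h
  have h2 : Complex.exp (x : ℂ) - (1 + x) = ((Real.exp x - (1 + x) : ℝ) : ℂ) := by push_cast; rfl
  rw [h2, Complex.norm_real] at h
  have h3 := (le_abs_self _).trans h
  have h4 : x ^ 2 * Real.exp |x| ≤ x ^ 2 * Real.exp B := by gcongr
  linarith

/-- Two-sided bounds on the logarithmic moment generating function of a bounded random variable
on a finite uniform space, in terms of its mean and variance. -/
lemma log_mean_exp_bounds {Ω : Type*} [Fintype Ω] {c : ℝ} (hc : 0 < c)
    (hcard : (Fintype.card Ω : ℝ) = c) (Y : Ω → ℝ) {m V s B : ℝ}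
    (hm : ∑ w, (Y w - m) = 0) (hV : (∑ w, (Y w - m) ^ 2) / c = V)
    (hB : ∀ w, |s * (Y w - m)| ≤ B) :
    s * m ≤ Real.log ((∑ w, Real.exp (s * Y w)) / c) ∧
      Real.log ((∑ w, Real.exp (s * Y w)) / c) ≤ s * m + s ^ 2 * Real.exp B * V := by
  have hone : ∑ _w : Ω, (1 : ℝ) = c := by simpa using hcard
  have hsum : ∑ w, Real.exp (s * Y w) =
      Real.exp (s * m) * ∑ w, Real.exp (s * (Y w - m)) := by
    rw [Finset.mul_sum]
    refine Finset.sum_congr rfl fun w _ => ?_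
    rw [← Real.exp_add]; ring_nf
  have hlow : c ≤ ∑ w, Real.exp (s * (Y w - m)) := by
    have : ∑ w, (1 + s * (Y w - m)) ≤ ∑ w, Real.exp (s * (Y w - m)) :=
      Finset.sum_le_sum fun w _ => by linarith [Real.add_one_le_exp (s * (Y w - m))]
    rwa [Finset.sum_add_distrib, ← Finset.mul_sum, hm, hone, mul_zero, add_zero] at this
  have hup : ∑ w, Real.exp (s * (Y w - m)) ≤ c * (1 + s ^ 2 * Real.exp B * V) := by
    calc _ ≤ ∑ w, (1 + s * (Y w - m) + s ^ 2 * Real.exp B * (Y w - m) ^ 2) :=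
          Finset.sum_le_sum fun w _ => by
            have := exp_le_one_add_add_sq_mul_exp (hB w)
            linarith
      _ = _ := by
          rw [Finset.sum_add_distrib, Finset.sum_add_distrib, ← Finset.mul_sum, ← Finset.mul_sum,
            hm, hone, ← hV]
          field_simp
          ring
  have hA : 0 < (∑ w, Real.exp (s * (Y w - m))) / c := div_pos (hc.trans_le hlow) hc
  rw [hsum, mul_div_assoc, Real.log_mul (Real.exp_pos _).ne' hA.ne', Real.log_exp]
  constructor
  · have := Real.log_nonneg ((one_le_div hc).2 hlow)
    linarith
  · have h1 := Real.log_le_sub_one_of_pos hA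
    have h2 := (div_le_iff₀' hc).2 hup
    linarith

lemma tendsto_scaled_log_mgf (k ℓ : ℕ) (hk : 1 ≤ k)
    (v : Fin ℓ → Fin k) (θ : ℕ → ℝ) (hθpos : ∀ n, 0 < θ n) (γ : ℝ)
    (hratio : Tendsto (fun n : ℕ => muX k ℓ v n / θ n) atTop (𝓝 γ))
    (s : ℕ → ℝ) (t : ℝ) (hs : Tendsto s atTop (𝓝 t)) :
    Tendsto (fun n : ℕ => θ n / muX k ℓ v n *
        Real.log ((∑ w : Fin n → Fin k, Real.exp (s n * ((occ k ℓ n v w : ℝ) / θ n)))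
          / (k : ℝ) ^ n))
      atTop (𝓝 t) := by
  have hk' : (0 : ℝ) < k := by exact_mod_cast hk
  have hp := patternProb_pos hk v
  set p := patternProb v with hpdef
  set G := γ + 1
  set S := |t| + 1
  set B := S * (G / p)
  set D : ℝ := 2 ^ ℓ * ℓ.factorial
  set K : ℝ := S ^ 2 * Real.exp B * G * (ℓ ^ 2 * D ^ 2 / p ^ 2)
  have hupper : Tendsto (fun n : ℕ => s n + K / n) atTop (𝓝 t) := by
    simpa using hs.add (tendsto_const_div_atTop_nhds_zero_nat K)
  have hev : ∀ᶠ n : ℕ in atTop, s n ≤ θ n / muX k ℓ v n *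
        Real.log ((∑ w : Fin n → Fin k, Real.exp (s n * ((occ k ℓ n v w : ℝ) / θ n)))
          / (k : ℝ) ^ n) ∧ θ n / muX k ℓ v n *
        Real.log ((∑ w : Fin n → Fin k, Real.exp (s n * ((occ k ℓ n v w : ℝ) / θ n)))
          / (k : ℝ) ^ n) ≤ s n + K / n := by
    filter_upwards [hratio.eventually_le_const (lt_add_one γ),
      hs.abs.eventually_le_const (lt_add_one |t|), eventually_ge_atTop (2 * ℓ),
      eventually_gt_atTop 0] with n hG hS hn hn0
    have hθ := hθpos n
    have hn0' : (0 : ℝ) < n := by exact_mod_cast hn0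
    have hN : (0 : ℝ) < n.choose ℓ := by exact_mod_cast Nat.choose_pos (by omega)
    have hmu := muX_eq hk v n
    have hvar := varX_mul_le hk v n
    have hpow := pow_le_mul_choose hn
    have hcard : (Fintype.card (Fin n → Fin k) : ℝ) = (k : ℝ) ^ n := by simp
    rw [← hpdef] at hmu
    set μ := muX k ℓ v n with hμdef
    set N : ℝ := (n.choose ℓ : ℝ)
    have hμ : 0 < μ := by rw [hmu]; positivity
    have hG0 : 0 ≤ G := (div_pos hμ hθ).le.trans hG
    have hV0 : 0 ≤ varX k ℓ v n :=
      div_nonneg (Finset.sum_nonneg fun w _ => sq_nonneg _) (by positivity)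
    have hNp : N / θ n ≤ G / p := by
      rw [le_div_iff₀ hp]
      calc N / θ n * p = μ / θ n := by rw [hmu]; ring
        _ ≤ G := hG
    have hp1 : μ ≤ N := by
      rw [hμdef, muX, div_le_iff₀ (by positivity)]
      calc _ ≤ ∑ w : Fin n → Fin k, N := Finset.sum_le_sum fun w _ => occ_le_choose v w
        _ = N * (k : ℝ) ^ n := by rw [Finset.sum_const, nsmul_eq_mul, Finset.card_univ, hcard,
              mul_comm]
    have hb := log_mean_exp_bounds (Ω := Fin n → Fin k) (c := (k : ℝ) ^ n) (by positivity) hcard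
      (fun w => (occ k ℓ n v w : ℝ) / θ n) (m := μ / θ n) (V := varX k ℓ v n / θ n ^ 2)
      (s := s n) (B := B) ?_ ?_ ?_
    · obtain ⟨hlo, hhi⟩ := hb
      have hr : 0 < θ n / μ := div_pos hθ hμ
      constructor
      · calc s n = θ n / μ * (s n * (μ / θ n)) := by field_simp
          _ ≤ _ := by gcongr
      · calc _ ≤ θ n / μ * (s n * (μ / θ n) + s n ^ 2 * Real.exp B * (varX k ℓ v n / θ n ^ 2)) := by
              gcongr
          _ = s n + s n ^ 2 * Real.exp B * (μ / θ n) * (varX k ℓ v n / μ ^ 2) := by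
              field_simp
          _ ≤ s n + S ^ 2 * Real.exp B * G * (ℓ ^ 2 * D ^ 2 / p ^ 2 / n) := by
              have h1 : s n ^ 2 ≤ S ^ 2 := by
                rw [← sq_abs]; gcongr
              have h2 : varX k ℓ v n / μ ^ 2 ≤ ℓ ^ 2 * D ^ 2 / p ^ 2 / n := by
                rw [hmu, div_div, div_le_div_iff₀ (by positivity) (by positivity)]
                have h3 : ((n : ℝ) ^ ℓ) ^ 2 ≤ (D * N) ^ 2 := by gcongr
                calc varX k ℓ v n * (p ^ 2 * n) = p ^ 2 * (varX k ℓ v n * n) := by ring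
                  _ ≤ p ^ 2 * (ℓ ^ 2 * (D * N) ^ 2) :=
                    mul_le_mul_of_nonneg_left (hvar.trans (by gcongr)) (sq_nonneg p)
                  _ = _ := by ring
              gcongr
          _ = _ := by simp only [K]; ring
    · rw [Finset.sum_sub_distrib, ← Finset.sum_div, Finset.sum_const, nsmul_eq_mul,
        Finset.card_univ, hcard, hμdef, muX]
      field_simp
      ring
    · rw [varX, div_right_comm, Finset.sum_div (a := θ n ^ 2)]
      congr 1
      refine Finset.sum_congr rfl fun w _ => ?_
      rw [← sub_div, div_pow]
    · intro w
      rw [← sub_div, abs_mul, abs_div, abs_of_pos hθ]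
      have h1 : |(occ k ℓ n v w : ℝ) - μ| ≤ N := by
        have := occ_le_choose v w
        have h0 : (0 : ℝ) ≤ occ k ℓ n v w := Nat.cast_nonneg _
        rw [abs_le]; constructor <;> linarith
      have h2 : |(occ k ℓ n v w : ℝ) - μ| / θ n ≤ G / p := le_trans (by gcongr) hNp
      exact mul_le_mul hS h2 (by positivity) (by positivity)
  exact tendsto_of_tendsto_of_tendsto_of_le_of_le' hs hupper (hev.mono fun _ h => h.1)
    (hev.mono fun _ h => h.2)

/-- Lemma (a): if `θ_n → ∞` and `μ_n/θ_n → γ ∈ [0,∞)`, then for every `t ∈ ℝ`,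
`(θ_n/μ_n)·log E(e^{tX_n/θ_n}) → t` and `(θ_n/μ_n)·log E((1+t/θ_n)^{X_n}) → t`. -/
theorem scaled_log_mgf_limits (k ℓ : ℕ) (hk : 1 ≤ k) (hl : 2 ≤ ℓ)
    (v : Fin ℓ → Fin k) (θ : ℕ → ℝ) (hθpos : ∀ n, 0 < θ n)
    (hθtop : Tendsto θ atTop atTop) (γ : ℝ) (hγ : 0 ≤ γ)
    (hratio : Tendsto (fun n : ℕ => muX k ℓ v n / θ n) atTop (𝓝 γ)) (t : ℝ) :
    Tendsto (fun n : ℕ => θ n / muX k ℓ v n *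
        Real.log ((∑ w : Fin n → Fin k, Real.exp (t * (occ k ℓ n v w : ℝ) / θ n))
          / (k : ℝ) ^ n))
      atTop (𝓝 t) ∧
    Tendsto (fun n : ℕ => θ n / muX k ℓ v n *
        Real.log ((∑ w : Fin n → Fin k, (1 + t / θ n) ^ (occ k ℓ n v w))
          / (k : ℝ) ^ n))
      atTop (𝓝 t) := by
  constructor
  · refine (tendsto_scaled_log_mgf k ℓ hk v θ hθpos γ hratio (fun _ => t) t
      tendsto_const_nhds).congr fun n => ?_
    simp only [mul_div_assoc]
  · refine (tendsto_scaled_log_mgf k ℓ hk v θ hθpos γ hratio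
      (fun n => θ n * Real.log (1 + t / θ n)) t
      ((Real.tendsto_mul_log_one_add_div_atTop t).comp hθtop)).congr' ?_
    have h0 : Tendsto (fun n => t / θ n) atTop (𝓝 0) := hθtop.const_div_atTop t
    filter_upwards [h0.eventually_const_lt (show (-1 : ℝ) < 0 by norm_num)] with n hn
    have hθ := hθpos n
    have h1 : 0 < 1 + t / θ n := by linarith
    congr 4
    ext w
    rw [← Real.exp_log (pow_pos h1 _), Real.log_pow]
    congr 1
    field_simp
end

section
/- Let (k_n), (ℓ_n), (d_n) be sequences of natural numbers satisfying: (i) d_n ≤ ℓ_n and d_n ≤ k_n for all n; (ii) δ := liminf_{n→∞} d_n/ℓ_n > 0; (iii) there exist constants A > 0 and β > 2/(2+δ) such that ℓ_n ≥ A·n^β for all n. For each n, let v_n ∈ [k_n]^{ℓ_n} be a pattern with exactly d_n distinct letters, let X_n = occ_{v_n}(W_n) where W_n is chosen uniformly at random from [k_n]^n, and let μ_n = C(n,ℓ_n)·C(k_n,d_n)/k_n^{ℓ_n} = E(X_n). Then lim_{n→∞} d_TV(X_n, Q_n) = 0, where Q_n is a Poisson random variable with parameter μ_n and d_TV denotes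 total variation distance. In particular, for every fixed integer r ≥ 0, lim_{n→∞} | f_r^{v_n}(k_n,n)/k_n^n − μ_n^r·e^{−μ_n}/r! | = 0. -/
open Filter Topology

open Finset in
/-- Order-isomorphic words with the same set of letters are equal. -/
lemma eq_of_orderIso_of_image_eq {k ℓ : ℕ} {v u u' : Fin ℓ → Fin k}
    (hu : ∀ p q, (u p < u q ↔ v p < v q) ∧ (u p = u q ↔ v p = v q))
    (hu' : ∀ p q, (u' p < u' q ↔ v p < v q) ∧ (u' p = u' q ↔ v p = v q))
    (him : univ.image u = univ.image u') : u = u' := by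
  have key : ∀ x : Fin k, ∀ p, v p = x → u p = u' p := by
    intro x
    induction x using WellFoundedLT.induction with
    | _ x ih =>
      rintro p rfl
      obtain ⟨q, -, hq⟩ := mem_image.1 (him ▸ mem_image_of_mem u (mem_univ p))
      obtain ⟨q', -, hq'⟩ := mem_image.1 (him.symm ▸ mem_image_of_mem u' (mem_univ p))
      rcases lt_trichotomy (v q) (v p) with h | h | h
      · have h1 := (hu q p).1.2 h
        rw [ih _ h q rfl, hq] at h1
        exact absurd h1 (lt_irrefl _)
      · rw [← hq, (hu' q p).2.2 h]
      rcases lt_trichotomy (v q') (v p) with h' | h' | h'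
      · have h1 := (hu' q' p).1.2 h'
        rw [← ih _ h' q' rfl, hq'] at h1
        exact absurd h1 (lt_irrefl _)
      · rw [← hq', (hu q' p).2.2 h']
      · have h1 := (hu' p q).1.2 h
        have h2 := (hu p q').1.2 h'
        rw [hq] at h1
        rw [hq'] at h2
        exact absurd h1 h2.not_gt
  exact funext fun p => key _ p rfl

open Finset in
/-- A word order-isomorphic to `v` has as many distinct letters as `v`. -/
lemma card_image_eq_dLetters {k ℓ : ℕ} {v u : Fin ℓ → Fin k}
    (hu : ∀ p q, u p = u q ↔ v p = v q) : (univ.image u).card = dLetters k ℓ v := by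
  unfold dLetters
  have key : ∀ f : Fin k × Fin k → Fin k,
      (∀ p q, f (u p, v p) = f (u q, v q) → u p = u q ∧ v p = v q) →
      (univ.image fun p => f (u p, v p)).card = (univ.image fun p => (u p, v p)).card := by
    intro f hf
    have himg : (univ.image fun p => f (u p, v p)) = (univ.image fun p => (u p, v p)).image f := by
      rw [image_image]; rfl
    rw [himg, card_image_iff]
    intro x hx y hy hxy
    obtain ⟨p, -, rfl⟩ := mem_image.1 (mem_coe.1 hx)
    obtain ⟨q, -, rfl⟩ := mem_image.1 (mem_coe.1 hy)
    exact Prod.ext (hf p q hxy).1 (hf p q hxy).2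
  exact (key Prod.fst fun p q h => ⟨h, (hu p q).1 h⟩).trans
    (key Prod.snd fun p q h => ⟨(hu p q).2 h, h⟩).symm

open Finset in
/-- The number of words in which a fixed increasing index tuple is an occurrence of `v`. -/
lemma card_words_with_occurrence_at_le {k ℓ n : ℕ} (v : Fin ℓ → Fin k) (j : Fin ℓ ↪o Fin n) :
    Nat.card {w : Fin n → Fin k // ∀ p q : Fin ℓ, (w (j p) < w (j q) ↔ v p < v q) ∧
      (w (j p) = w (j q) ↔ v p = v q)} ≤ k.choose (dLetters k ℓ v) * k ^ (n - ℓ) := by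
  classical
  have hc : Nat.card ((powersetCard (dLetters k ℓ v) (univ : Finset (Fin k))) ×
      ({i : Fin n // i ∉ Set.range j} → Fin k)) = k.choose (dLetters k ℓ v) * k ^ (n - ℓ) := by
    have : Fintype.card {i : Fin n // i ∉ Set.range j} = n - ℓ := by
      rw [Fintype.card_subtype_compl]
      congr 1
      · simp
      · rw [← Nat.card_eq_fintype_card]
        exact (Nat.card_range_of_injective j.injective).trans (Nat.card_fin ℓ)
    rw [Nat.card_prod, Nat.card_eq_fintype_card, Nat.card_eq_fintype_card, Fintype.card_coe,
      card_powersetCard, Fintype.card_fun, this]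
    simp
  rw [← hc]
  refine Nat.card_le_card_of_injective (fun w => (⟨univ.image (w.1 ∘ j), ?_⟩, fun i => w.1 i)) ?_
  · rw [mem_powersetCard]
    exact ⟨subset_univ _, card_image_eq_dLetters fun p q => (w.2 p q).2⟩
  · rintro ⟨w, hw⟩ ⟨w', hw'⟩ h
    simp only [Prod.mk.injEq, Subtype.mk.injEq] at h
    have h1 := eq_of_orderIso_of_image_eq (u := w ∘ j) (u' := w' ∘ j) hw hw' h.1
    ext1
    funext i
    by_cases hi : i ∈ Set.range j
    · obtain ⟨p, rfl⟩ := hi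
      exact congrFun h1 p
    · exact congrFun h.2 ⟨i, hi⟩

open Finset in
/-- Union bound for the number of words containing the pattern. -/
lemma card_occ_ne_zero_le {k ℓ n : ℕ} (v : Fin ℓ → Fin k) :
    Nat.card {w : Fin n → Fin k // occ k ℓ n v w ≠ 0} ≤
      n.choose ℓ * (k.choose (dLetters k ℓ v) * k ^ (n - ℓ)) := by
  classical
  let good : (Fin ℓ ↪o Fin n) → (Fin n → Fin k) → Prop := fun j w =>
    ∀ p q : Fin ℓ, (w (j p) < w (j q) ↔ v p < v q) ∧ (w (j p) = w (j q) ↔ v p = v q)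
  have hsub : univ.filter (fun w : Fin n → Fin k => occ k ℓ n v w ≠ 0) ⊆
      univ.biUnion fun j : Fin ℓ ↪o Fin n => univ.filter (good j) := by
    intro w hw
    simp only [mem_filter, mem_univ, true_and, mem_biUnion] at hw ⊢
    obtain ⟨⟨j, hj, hjw⟩⟩ := (Nat.card_ne_zero.1 hw).1
    exact ⟨OrderEmbedding.ofStrictMono j hj, hjw⟩
  rw [Nat.card_eq_fintype_card, Fintype.card_subtype]
  calc _ ≤ _ := card_le_card hsub
    _ ≤ (univ : Finset (Fin ℓ ↪o Fin n)).card * _ := card_biUnion_le_card_mul _ _ _ fun j _ => by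
        have := card_words_with_occurrence_at_le v j
        rwa [Nat.card_eq_fintype_card, Fintype.card_subtype] at this
    _ = _ := by
      congr 1
      rw [card_univ, ← Nat.card_eq_fintype_card]
      rw [Nat.card_congr Set.powersetCard.ofFinEmbEquiv, Set.powersetCard.card, Nat.card_fin]

/-- Two probability mass functions on `ℕ` which nearly concentrate at `0` are close. -/
lemma abs_tsum_sub_tsum_le {p q : ℕ → ℝ} {ε : ℝ} (hp : ∀ r, 0 ≤ p r) (hq : ∀ r, 0 ≤ q r)
    (hps : HasSum p 1) (hqs : HasSum q 1) (hp0 : 1 - p 0 ≤ ε) (hq0 : 1 - q 0 ≤ ε)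
    (S : Set ℕ) : |(∑' r : S, p r) - ∑' r : S, q r| ≤ ε := by
  have mass : ∀ f : ℕ → ℝ, (∀ r, 0 ≤ f r) → HasSum f 1 →
      (0 ∈ S → f 0 ≤ ∑' r : S, f r) ∧ (0 ∉ S → ∑' r : S, f r ≤ 1 - f 0) ∧
      0 ≤ ∑' r : S, f r ∧ ∑' r : S, f r ≤ 1 := by
    intro f hf hs
    have hadd := hs.summable.tsum_subtype_add_tsum_subtype_compl S
    rw [hs.tsum_eq] at hadd
    have h0 : 0 ≤ ∑' r : S, f r := tsum_nonneg fun r => hf r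
    have h0' : 0 ≤ ∑' r : (Sᶜ : Set ℕ), f r := tsum_nonneg fun r => hf r
    have hle : ∀ T : Set ℕ, 0 ∈ T → f 0 ≤ ∑' r : T, f r := fun T hT =>
      (hs.summable.subtype T).le_tsum (⟨0, hT⟩ : T) fun r _ => hf _
    refine ⟨hle S, fun h => ?_, h0, by linarith⟩
    have := hle Sᶜ h
    linarith
  obtain ⟨a1, a2, a3, a4⟩ := mass p hp hps
  obtain ⟨b1, b2, b3, b4⟩ := mass q hq hqs
  rw [abs_le]
  by_cases h : 0 ∈ S
  · have := a1 h
    have := b1 h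
    constructor <;> linarith
  · have := a2 h
    have := b2 h
    constructor <;> linarith

open Finset in
lemma hasSum_fword_div {k ℓ n : ℕ} (hk : 0 < k) (v : Fin ℓ → Fin k) :
    HasSum (fun r => (fword k ℓ v r n : ℝ) / (k : ℝ) ^ n) 1 := by
  classical
  have hf : ∀ r, fword k ℓ v r n = (univ.filter fun w => occ k ℓ n v w = r).card := fun r => by
    rw [fword, Nat.card_eq_fintype_card, Fintype.card_subtype]
  have hsum : ∑ r ∈ univ.image (occ k ℓ n v), (fword k ℓ v r n : ℝ) / (k : ℝ) ^ n = 1 := by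
    have hcard := card_eq_sum_card_image (occ k ℓ n v) univ
    rw [card_univ, Fintype.card_fun, Fintype.card_fin, Fintype.card_fin] at hcard
    rw [← sum_div, div_eq_one_iff_eq (by positivity)]
    simp only [hf]
    exact_mod_cast hcard.symm
  rw [← hsum]
  refine hasSum_sum_of_ne_finset_zero fun r hr => ?_
  rw [hf, filter_eq_empty_iff.2, card_empty, Nat.cast_zero, zero_div]
  exact fun w _ h => hr (mem_image.2 ⟨w, mem_univ _, h⟩)

/-- First moment bound for the probability that the pattern occurs. -/
lemma one_sub_fword_zero_div_le {k ℓ n : ℕ} (hk : 0 < k) (v : Fin ℓ → Fin k) :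
    1 - (fword k ℓ v 0 n : ℝ) / (k : ℝ) ^ n ≤
      (n.choose ℓ : ℝ) * (k.choose (dLetters k ℓ v) : ℝ) / (k : ℝ) ^ ℓ := by
  classical
  have htot : fword k ℓ v 0 n + Nat.card {w : Fin n → Fin k // occ k ℓ n v w ≠ 0} = k ^ n := by
    rw [fword, Nat.card_eq_fintype_card, Nat.card_eq_fintype_card, Fintype.card_subtype_compl,
      Nat.add_sub_cancel' (Fintype.card_subtype_le _)]
    simp
  have hle := card_occ_ne_zero_le (n := n) v
  have hk' : (0 : ℝ) < k := by exact_mod_cast hk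
  have htot' : (fword k ℓ v 0 n : ℝ) +
      Nat.card {w : Fin n → Fin k // occ k ℓ n v w ≠ 0} = (k : ℝ) ^ n := by exact_mod_cast htot
  have hle' : (Nat.card {w : Fin n → Fin k // occ k ℓ n v w ≠ 0} : ℝ) ≤
      n.choose ℓ * (k.choose (dLetters k ℓ v) * (k : ℝ) ^ (n - ℓ)) := by exact_mod_cast hle
  rw [one_sub_div (by positivity), ← htot', add_sub_cancel_left, htot']
  refine (div_le_div_of_nonneg_right hle' (by positivity)).trans ?_
  rcases le_or_gt ℓ n with h | h
  · obtain ⟨m, rfl⟩ := Nat.exists_eq_add_of_le h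
    rw [Nat.add_sub_cancel_left, pow_add]
    apply le_of_eq
    field_simp
  · simp [Nat.choose_eq_zero_of_lt h]

/-- The Poisson parameter is super-exponentially small in the length of the pattern. -/
lemma mean_le_pow {k ℓ d n : ℕ} (hd : 0 < d) (hdl : d ≤ ℓ) (hdk : d ≤ k) :
    (n.choose ℓ : ℝ) * (k.choose d : ℝ) / (k : ℝ) ^ ℓ ≤
      (Real.exp 1 ^ 2 * n / (ℓ * d)) ^ ℓ := by
  have hd' : (0 : ℝ) < d := by exact_mod_cast hd
  have hl' : (0 : ℝ) < ℓ := by exact_mod_cast hd.trans_le hdl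
  have hk' : (0 : ℝ) < k := by exact_mod_cast hd.trans_le hdk
  have fact : ∀ m : ℕ, (0 : ℝ) < m → (1 : ℝ) / m.factorial ≤ Real.exp 1 ^ m / (m : ℝ) ^ m := by
    intro m hm
    have := Real.pow_div_factorial_le_exp (m : ℝ) hm.le m
    rw [← Real.exp_one_pow, div_le_iff₀ (by positivity)] at this
    rw [div_le_div_iff₀ (by positivity) (by positivity), one_mul]
    exact this
  have h1 : (n.choose ℓ : ℝ) ≤ (n : ℝ) ^ ℓ * (Real.exp 1 ^ ℓ / (ℓ : ℝ) ^ ℓ) := by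
    refine (Nat.choose_le_pow_div ℓ n).trans ?_
    rw [div_eq_mul_one_div]
    exact mul_le_mul_of_nonneg_left (fact ℓ hl') (by positivity)
  have h2 : (k.choose d : ℝ) ≤ (k : ℝ) ^ d * (Real.exp 1 ^ ℓ / (d : ℝ) ^ d) := by
    refine (Nat.choose_le_pow_div d k).trans ?_
    rw [div_eq_mul_one_div]
    refine mul_le_mul_of_nonneg_left ((fact d hd').trans ?_) (by positivity)
    gcongr
    exact Real.one_le_exp zero_le_one
  have h3 : (d : ℝ) ^ (ℓ - d) ≤ (k : ℝ) ^ (ℓ - d) := by gcongr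
  have hkl : (k : ℝ) ^ ℓ = (k : ℝ) ^ d * (k : ℝ) ^ (ℓ - d) := by
    rw [← pow_add, Nat.add_sub_cancel' hdl]
  have hdl' : (d : ℝ) ^ ℓ = (d : ℝ) ^ d * (d : ℝ) ^ (ℓ - d) := by
    rw [← pow_add, Nat.add_sub_cancel' hdl]
  calc _ ≤ ((n : ℝ) ^ ℓ * (Real.exp 1 ^ ℓ / (ℓ : ℝ) ^ ℓ)) *
        ((k : ℝ) ^ d * (Real.exp 1 ^ ℓ / (d : ℝ) ^ d)) / (k : ℝ) ^ ℓ := by gcongr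
    _ = ((n : ℝ) ^ ℓ * Real.exp 1 ^ ℓ * Real.exp 1 ^ ℓ / ((ℓ : ℝ) ^ ℓ * (d : ℝ) ^ d)) /
        (k : ℝ) ^ (ℓ - d) := by rw [hkl]; field_simp
    _ ≤ ((n : ℝ) ^ ℓ * Real.exp 1 ^ ℓ * Real.exp 1 ^ ℓ / ((ℓ : ℝ) ^ ℓ * (d : ℝ) ^ d)) /
        (d : ℝ) ^ (ℓ - d) := by gcongr
    _ = _ := by
      rw [div_pow, mul_pow, mul_pow, hdl', ← pow_mul, mul_comm 2 ℓ, pow_mul]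
      field_simp

/-- Under the growth assumptions the Poisson parameter tends to `0`. -/
lemma tendsto_mean_zero {k ℓ d : ℕ → ℕ} (hdl : ∀ n, d n ≤ ℓ n) (hdk : ∀ n, d n ≤ k n)
    {c A β : ℝ} (hc : 0 < c) (hA : 0 < A) (hβ : 1 / 2 < β)
    (hd : ∀ᶠ n in atTop, c < (d n : ℝ) / ℓ n) (hℓ : ∀ n : ℕ, A * (n : ℝ) ^ β ≤ ℓ n) :
    Tendsto (fun n : ℕ =>
      (n.choose (ℓ n) : ℝ) * ((k n).choose (d n) : ℝ) / (k n : ℝ) ^ ℓ n) atTop (𝓝 0) := by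
  set C : ℝ := Real.exp 1 ^ 2 / (c * A ^ 2)
  have hlim : Tendsto (fun n : ℕ => C * (n : ℝ) ^ (-(2 * β - 1))) atTop (𝓝 0) := by
    have := ((tendsto_rpow_neg_atTop (y := 2 * β - 1) (by linarith)).comp
      tendsto_natCast_atTop_atTop).const_mul C
    simpa using this
  refine tendsto_of_tendsto_of_tendsto_of_le_of_le' tendsto_const_nhds hlim
    (Eventually.of_forall fun n => by positivity) ?_
  filter_upwards [hd, eventually_gt_atTop 0, hlim.eventually (ge_mem_nhds one_pos)]
    with n hn hn0 hn1
  have hn' : (0 : ℝ) < n := by exact_mod_cast hn0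
  have hl : (0 : ℝ) < ℓ n := lt_of_lt_of_le (by positivity) (hℓ n)
  have hcd : c * ℓ n < d n := (lt_div_iff₀ hl).1 hn
  have hd0 : (0 : ℝ) < d n := lt_trans (by positivity) hcd
  have hbase : Real.exp 1 ^ 2 * n / (ℓ n * d n) ≤ C * (n : ℝ) ^ (-(2 * β - 1)) := by
    have hden : c * A ^ 2 * ((n : ℝ) ^ β) ^ 2 ≤ ℓ n * d n :=
      calc c * A ^ 2 * ((n : ℝ) ^ β) ^ 2 = c * (A * (n : ℝ) ^ β) ^ 2 := by ring
        _ ≤ c * (ℓ n : ℝ) ^ 2 := by gcongr; exact hℓ n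
        _ = ℓ n * (c * ℓ n) := by ring
        _ ≤ ℓ n * d n := by gcongr
    calc _ ≤ Real.exp 1 ^ 2 * n / (c * A ^ 2 * ((n : ℝ) ^ β) ^ 2) := by gcongr
      _ = _ := by
        rw [neg_sub, Real.rpow_sub hn', Real.rpow_one, mul_comm 2 β, Real.rpow_mul hn'.le]
        simp only [C, Real.rpow_ofNat]
        field_simp
  refine (mean_le_pow (by exact_mod_cast hd0) (hdl n) (hdk n)).trans ?_
  have hl1 : ℓ n ≠ 0 := by rintro h; simp [h] at hl
  exact (pow_le_of_le_one (by positivity) (hbase.trans hn1) hl1).trans hbase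

/-- Theorem F (Poisson approximation): for sequences `k_n, ℓ_n, d_n` with
`d_n ≤ min(k_n, ℓ_n)`, `δ = liminf d_n/ℓ_n > 0`, and `ℓ_n ≥ A n^β` with
`β > 2/(2+δ)`, and patterns `v_n ∈ [k_n]^{ℓ_n}` with exactly `d_n` distinct letters,
the total variation distance between `X_n = occ_{v_n}(W_n)` (for uniformly random
`W_n ∈ [k_n]^n`) and a Poisson variable with parameter `μ_n` tends to `0`; in
particular `|f_r^{v_n}(k_n,n)/k_n^n - μ_n^r e^{-μ_n}/r!| → 0` for every fixed `r`. -/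
theorem poisson_approximation
    (k ℓ d : ℕ → ℕ)
    (hdl : ∀ n, d n ≤ ℓ n) (hdk : ∀ n, d n ≤ k n)
    (δ : ℝ) (hδdef : δ = Filter.liminf (fun n : ℕ => (d n : ℝ) / (ℓ n : ℝ)) atTop)
    (hδpos : 0 < δ)
    (A β : ℝ) (hA : 0 < A) (hβ : 2 / (2 + δ) < β)
    (hℓgrow : ∀ n : ℕ, A * (n : ℝ) ^ β ≤ (ℓ n : ℝ))
    (v : ∀ n : ℕ, Fin (ℓ n) → Fin (k n))
    (hv : ∀ n, dLetters (k n) (ℓ n) (v n) = d n) :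
    let μ : ℕ → ℝ := fun n =>
      (n.choose (ℓ n) : ℝ) * ((k n).choose (d n) : ℝ) / (k n : ℝ) ^ (ℓ n)
    let pX : ℕ → ℕ → ℝ := fun n r => (fword (k n) (ℓ n) (v n) r n : ℝ) / (k n : ℝ) ^ n
    let pQ : ℕ → ℕ → ℝ := fun n r => μ n ^ r * Real.exp (-μ n) / (r.factorial : ℝ)
    Tendsto (fun n : ℕ =>
        ⨆ S : Set ℕ, |(∑' r : S, pX n (r : ℕ)) - ∑' r : S, pQ n (r : ℕ)|)
      atTop (𝓝 0) ∧
    ∀ r : ℕ, Tendsto (fun n : ℕ => |pX n r - pQ n r|) atTop (𝓝 0) := by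
  intro μ pX pQ
  have hδ1 : ∀ᶠ n in atTop, δ / 2 < (d n : ℝ) / ℓ n := by
    refine eventually_lt_of_lt_liminf (by rw [← hδdef]; linarith) ?_
    exact isBoundedUnder_of ⟨0, fun n => by positivity⟩
  have hδle : δ ≤ 1 := by
    rw [hδdef]
    refine liminf_le_of_le (isBoundedUnder_of ⟨0, fun n => by positivity⟩) fun b hb => ?_
    obtain ⟨n, hn⟩ := hb.exists
    exact hn.trans (div_le_one_of_le₀ (by exact_mod_cast hdl n) (by positivity))
  have hβ' : 1 / 2 < β := by
    refine lt_trans ?_ hβ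
    rw [div_lt_div_iff₀ two_pos (by linarith)]
    linarith
  have hμ : Tendsto μ atTop (𝓝 0) :=
    tendsto_mean_zero hdl hdk (half_pos hδpos) hA hβ' hδ1 hℓgrow
  have hbound : ∀ᶠ n in atTop, ∀ S : Set ℕ,
      |(∑' r : S, pX n (r : ℕ)) - ∑' r : S, pQ n (r : ℕ)| ≤ μ n := by
    filter_upwards [eventually_gt_atTop 0] with n hn S
    have hl : 0 < ℓ n := by
      have hn' : (0 : ℝ) < n := by exact_mod_cast hn
      have hl' : (0 : ℝ) < ℓ n := lt_of_lt_of_le (by positivity) (hℓgrow n)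
      exact_mod_cast hl'
    have hk : 0 < k n := (v n ⟨0, hl⟩).pos
    have hμ0 : 0 ≤ μ n := by positivity
    refine abs_tsum_sub_tsum_le (fun r => by positivity) (fun r => by positivity)
      (hasSum_fword_div hk (v n)) ?_ ?_ ?_ S
    · have := (NormedSpace.expSeries_div_hasSum_exp (μ n)).mul_right (Real.exp (-μ n))
      rw [← Real.exp_eq_exp_ℝ, ← Real.exp_add, add_neg_cancel, Real.exp_zero] at this
      exact this.congr_fun fun r => by simp only [pQ]; ring
    · have := one_sub_fword_zero_div_le (n := n) hk (v n)
      rwa [hv n] at this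
    · have := Real.add_one_le_exp (-μ n)
      simp only [pQ, pow_zero, one_mul, Nat.factorial_zero, Nat.cast_one, div_one]
      linarith
  refine ⟨?_, fun r => ?_⟩
  · refine tendsto_of_tendsto_of_tendsto_of_le_of_le' tendsto_const_nhds hμ
      (Eventually.of_forall fun n => Real.iSup_nonneg fun S => abs_nonneg _) ?_
    filter_upwards [hbound] with n hn using ciSup_le hn
  · refine tendsto_of_tendsto_of_tendsto_of_le_of_le' tendsto_const_nhds hμ
      (Eventually.of_forall fun n => abs_nonneg _) ?_
    filter_upwards [hbound] with n hn
    simpa using hn {r}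
end

section
/- For all m, n ≥ 1 and every x ∈ [0,1], c_{k,n+m}^v(x) ≤ c_{k,n}^v(x)·c_{k,m}^v(x). Consequently, for every x ∈ [0,1] the limit lim_{n→∞} (c_{k,n}^v(x))^{1/n} exists and lies in the closed interval [d−1, k], where d is the number of distinct letters in v. -/
open Filter Topology

/-- The weak-avoidance partition function `c_{k,n}^v(x) = Σ_{w ∈ [k]^n} (1-x)^{occ_v(w)}`. -/
noncomputable def cfun (k ℓ : ℕ) (v : Fin ℓ → Fin k) (n : ℕ) (x : ℝ) : ℝ :=
  ∑ w : Fin n → Fin k, (1 - x) ^ (occ k ℓ n v w)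

/-- A multiplicative form of Fekete's lemma: the `n`-th roots of a nonnegative submultiplicative
sequence converge to their infimum. Unlike `Subadditive.tendsto_lim`, no lower bound on the
logarithms is required, so the limit may be zero. -/
theorem tendsto_rpow_inv_sInf_of_submultiplicative {c : ℕ → ℝ} (hc : ∀ n, 0 ≤ c n)
    (hmul : ∀ m n, c (m + n) ≤ c m * c n) :
    Tendsto (fun n : ℕ => c n ^ ((n : ℝ)⁻¹)) atTop
      (𝓝 (sInf ((fun n : ℕ => c n ^ ((n : ℝ)⁻¹)) '' Set.Ici 1))) := by
  set S := (fun n : ℕ => c n ^ ((n : ℝ)⁻¹)) '' Set.Ici 1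
  have hnonneg : ∀ y ∈ S, 0 ≤ y := by
    rintro _ ⟨n, -, rfl⟩
    exact Real.rpow_nonneg (hc n) _
  have hbdd : BddBelow S := ⟨0, hnonneg⟩
  have hne : S.Nonempty := ⟨_, 1, Set.mem_Ici.2 le_rfl, rfl⟩
  refine tendsto_order.2 ⟨fun a ha => ?_, fun b hb => ?_⟩
  · filter_upwards [eventually_ge_atTop 1] with n hn
    exact ha.trans_le (csInf_le hbdd ⟨n, hn, rfl⟩)
  have hb0 : 0 < b := (Real.sInf_nonneg hnonneg).trans_lt hb
  by_cases hz : ∃ N, c N = 0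
  · obtain ⟨N, hN⟩ := hz
    filter_upwards [eventually_ge_atTop N, eventually_ge_atTop 1] with n hn hn1
    have hcn : c n = 0 := by
      refine le_antisymm ?_ (hc n)
      have := hmul N (n - N)
      rwa [Nat.add_sub_cancel' hn, hN, zero_mul] at this
    have : ((n : ℝ)⁻¹) ≠ 0 := inv_ne_zero (by exact_mod_cast (by omega : n ≠ 0))
    rwa [hcn, Real.zero_rpow this]
  · push Not at hz
    have hpos : ∀ n, 0 < c n := fun n => (hc n).lt_of_ne' (hz n)
    have hsub : Subadditive fun n => Real.log (c n) := fun m n => by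
      rw [← Real.log_mul (hz m) (hz n)]
      exact Real.log_le_log (hpos _) (hmul m n)
    have hiff : ∀ n : ℕ, c n ^ ((n : ℝ)⁻¹) < b ↔ Real.log (c n) / n < Real.log b := fun n => by
      rw [← Real.log_lt_log_iff (Real.rpow_pos_of_pos (hpos n) _) hb0, Real.log_rpow (hpos n),
        div_eq_inv_mul]
    obtain ⟨_, ⟨n, hn, rfl⟩, hnb⟩ := exists_lt_of_csInf_lt hne hb
    have hn0 : n ≠ 0 := Nat.one_le_iff_ne_zero.1 hn
    exact (hsub.eventually_div_lt_of_div_lt hn0 ((hiff n).1 hnb)).mono fun p hp => (hiff p).2 hp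

/-- Concatenating two words keeps the occurrences of a nonempty pattern in each of them. -/
theorem occ_add_occ_le_occ_append {k ℓ : ℕ} (hl : ℓ ≠ 0) (v : Fin ℓ → Fin k) {n m : ℕ}
    (a : Fin n → Fin k) (b : Fin m → Fin k) :
    occ k ℓ n v a + occ k ℓ m v b ≤ occ k ℓ (n + m) v (Fin.append a b) := by
  unfold occ
  rw [← Nat.card_sum]
  refine Nat.card_le_card_of_injective
    (Sum.elim
      (fun j => ⟨fun p => Fin.castAdd m (j.1 p), fun p q h => j.2.1 h, fun p q => by
        simpa only [Fin.append_left] using j.2.2 p q⟩)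
      (fun j => ⟨fun p => Fin.natAdd n (j.1 p),
        fun p q h => (Fin.strictMono_natAdd n) (j.2.1 h), fun p q => by
        simpa only [Fin.append_right] using j.2.2 p q⟩)) ?_
  refine Function.Injective.sumElim ?_ ?_ ?_
  · intro i j h
    refine Subtype.ext (funext fun p => ?_)
    exact Fin.castAdd_injective n m (congrFun (congrArg Subtype.val h) p)
  · intro i j h
    refine Subtype.ext (funext fun p => ?_)
    exact Fin.natAdd_injective m n (congrFun (congrArg Subtype.val h) p)
  · intro i j h
    have h' := congrArg Fin.val (congrFun (congrArg Subtype.val h) ⟨0, Nat.pos_of_ne_zero hl⟩)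
    have h₁ := (i.1 ⟨0, Nat.pos_of_ne_zero hl⟩).isLt
    simp only [Fin.val_castAdd, Fin.val_natAdd] at h'
    omega

theorem cfun_nonneg {k ℓ : ℕ} (v : Fin ℓ → Fin k) (n : ℕ) {x : ℝ} (hx : x ≤ 1) :
    0 ≤ cfun k ℓ v n x :=
  Finset.sum_nonneg fun _ _ => pow_nonneg (sub_nonneg.2 hx) _

theorem cfun_add_le_mul {k ℓ : ℕ} (hl : ℓ ≠ 0) (v : Fin ℓ → Fin k) (n m : ℕ) {x : ℝ}
    (hx : x ∈ Set.Icc (0 : ℝ) 1) :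
    cfun k ℓ v (n + m) x ≤ cfun k ℓ v n x * cfun k ℓ v m x := by
  have h0 : 0 ≤ 1 - x := sub_nonneg.2 hx.2
  have h1 : 1 - x ≤ 1 := sub_le_self 1 hx.1
  unfold cfun
  rw [← (Fin.appendEquiv n m).sum_comp, Fintype.sum_prod_type, Finset.sum_mul_sum]
  refine Finset.sum_le_sum fun a _ => Finset.sum_le_sum fun b _ => ?_
  rw [← pow_add]
  exact pow_le_pow_of_le_one h0 h1 (occ_add_occ_le_occ_append hl v a b)

theorem cfun_le_pow {k ℓ : ℕ} (v : Fin ℓ → Fin k) (n : ℕ) {x : ℝ} (hx : x ∈ Set.Icc (0 : ℝ) 1) :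
    cfun k ℓ v n x ≤ (k : ℝ) ^ n := by
  calc cfun k ℓ v n x ≤ ∑ _w : Fin n → Fin k, (1 : ℝ) :=
        Finset.sum_le_sum fun w _ =>
          pow_le_one₀ (sub_nonneg.2 hx.2) (sub_le_self 1 hx.1)
    _ = (k : ℝ) ^ n := by simp

/-- A word using fewer distinct letters than the pattern avoids it. -/
theorem occ_eq_zero_of_card_lt {k ℓ n : ℕ} (v : Fin ℓ → Fin k) (w : Fin n → Fin k)
    {s : Finset (Fin k)} (hs : s.card < dLetters k ℓ v) (hw : ∀ i, w i ∈ s) :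
    occ k ℓ n v w = 0 := by
  unfold occ
  rw [Nat.card_eq_zero]
  refine Or.inl ⟨fun ⟨j, _, hj⟩ => hs.not_ge ?_⟩
  have hcard : dLetters k ℓ v ≤ (Finset.univ.image fun p => w (j p)).card := by
    refine Finset.card_le_card_of_forall_subsingleton
      (fun a b => ∃ p, v p = a ∧ w (j p) = b) ?_ ?_
    · intro a ha
      obtain ⟨p, -, rfl⟩ := Finset.mem_image.1 ha
      exact ⟨_, Finset.mem_image_of_mem _ (Finset.mem_univ p), p, rfl, rfl⟩
    · rintro b - _ ⟨-, p, rfl, hp⟩ _ ⟨-, q, rfl, hq⟩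
      exact (hj p q).2.1 (hp.trans hq.symm)
  refine hcard.trans (Finset.card_le_card fun b hb => ?_)
  obtain ⟨p, -, rfl⟩ := Finset.mem_image.1 hb
  exact hw _

theorem pow_dLetters_sub_one_le_cfun {k ℓ : ℕ} (hl : ℓ ≠ 0) (v : Fin ℓ → Fin k) (n : ℕ) {x : ℝ}
    (hx : x ≤ 1) : ((dLetters k ℓ v : ℝ) - 1) ^ n ≤ cfun k ℓ v n x := by
  let p : Fin ℓ := ⟨0, Nat.pos_of_ne_zero hl⟩
  have hp : v p ∈ Finset.univ.image v := Finset.mem_image_of_mem v (Finset.mem_univ p)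
  let s := (Finset.univ.image v).erase (v p)
  have hs : s.card + 1 = dLetters k ℓ v := Finset.card_erase_add_one hp
  calc ((dLetters k ℓ v : ℝ) - 1) ^ n
      = ∑ w ∈ Fintype.piFinset fun _ : Fin n => s, (1 - x) ^ occ k ℓ n v w := by
        have hocc : ∀ w ∈ Fintype.piFinset fun _ : Fin n => s, (1 - x) ^ occ k ℓ n v w = 1 :=
          fun w hw => by
            rw [occ_eq_zero_of_card_lt v w (by omega) (Fintype.mem_piFinset.1 hw), pow_zero]
        rw [Finset.sum_congr rfl hocc]
        simp [← hs]
    _ ≤ cfun k ℓ v n x :=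
        Finset.sum_le_sum_of_subset_of_nonneg (Finset.subset_univ _)
          fun _ _ _ => pow_nonneg (sub_nonneg.2 hx) _

/-- Submultiplicativity of the weak-avoidance partition function and existence of its
Stanley–Wilf-type limit: `c_{k,n+m}^v(x) ≤ c_{k,n}^v(x)·c_{k,m}^v(x)` for all `m,n ≥ 1`
and `x ∈ [0,1]`, and consequently `lim_n (c_{k,n}^v(x))^{1/n}` exists in `[d-1, k]`. -/
theorem cfun_submultiplicative_and_limit (k ℓ : ℕ) (hk : 1 ≤ k) (hl : 2 ≤ ℓ)
    (v : Fin ℓ → Fin k) :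
    (∀ m n : ℕ, 1 ≤ m → 1 ≤ n → ∀ x ∈ Set.Icc (0 : ℝ) 1,
      cfun k ℓ v (n + m) x ≤ cfun k ℓ v n x * cfun k ℓ v m x) ∧
    ∀ x ∈ Set.Icc (0 : ℝ) 1, ∃ L : ℝ,
      ((dLetters k ℓ v : ℝ) - 1 ≤ L ∧ L ≤ (k : ℝ)) ∧
      Tendsto (fun n : ℕ => cfun k ℓ v n x ^ ((n : ℝ)⁻¹)) atTop (𝓝 L) := by
  have hl0 : ℓ ≠ 0 := by omega
  refine ⟨fun m n _ _ x hx => cfun_add_le_mul hl0 v n m hx, fun x hx => ?_⟩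
  have hlim := tendsto_rpow_inv_sInf_of_submultiplicative
    (fun n => cfun_nonneg v n hx.2) fun n m => cfun_add_le_mul hl0 v n m hx
  have hd : (0 : ℝ) ≤ (dLetters k ℓ v : ℝ) - 1 := by
    have : 1 ≤ dLetters k ℓ v :=
      Finset.card_pos.2 ⟨_, Finset.mem_image_of_mem v (Finset.mem_univ ⟨0, by omega⟩)⟩
    exact sub_nonneg.2 (by exact_mod_cast this)
  refine ⟨_, ⟨ge_of_tendsto hlim ?_, le_of_tendsto hlim ?_⟩, hlim⟩
  · filter_upwards [eventually_ne_atTop 0] with n hn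
    rw [← Real.pow_rpow_inv_natCast hd hn]
    exact Real.rpow_le_rpow (pow_nonneg hd n) (pow_dLetters_sub_one_le_cfun hl0 v n hx.2)
      (by positivity)
  · filter_upwards [eventually_ne_atTop 0] with n hn
    rw [← Real.pow_rpow_inv_natCast k.cast_nonneg hn]
    exact Real.rpow_le_rpow (cfun_nonneg v n hx.2) (cfun_le_pow v n hx) (by positivity)
end
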